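/- Let p be a prime, ε ∈ ℤ_p^×, and m ≥ 2 an integer. Let L be a positive definite half-integral ternary form whose Gram matrix is ℤ_p-equivalent to H ⊕ [p^m·ε]. Define Λ_p(L) := {x ∈ ℤ³ : f_L(x+z) ≡ f_L(z) (mod p) for all z ∈ ℤ³}, on which f_L takes values in p²ℤ, and let K := λ_p(L) be the form (1/p²)·f_L restricted to Λ_p(L). Let L₁, …, L_g be pairwise non-ℤ-equivalent positive definite half-integral ternary forms, each ℤ_q-equivalent to L at every prime q and with λ_p(L_i) ℤ-equivalent to K, such that every positive definite half-integral ternary form with these two properties is ℤ-equivalent to some L_i. Then for every positive integer n divisible by p: Σ_{i=1}^{g} r(n,L_i)/o(L_i) = p·r(n,K)/o(K) + (p(p−1)/2)·r(n/p², K)/o(K) if m = 2, and Σ_{i=1}^{g} r(n,L_i)/o(L_i) = p·r(n,K)/o(K) + p²·r(n/p², K)/o(K) − p·#{x ∈ Λ_p(K) : f_K(x) = n}/o(K) if m ≥ 3, where Λ_p(K) := {x ∈ ℤ³ : f_K(x+z) ≡ f_K(z) (mod p) for all z ∈ ℤ³} and r(n/p², K) := 0 when p² ∤ n. -/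

import Mathlib

open Matrix

noncomputable section

/-- The image of an integral matrix in the rational matrices. -/
def intMap (X : Matrix (Fin 3) (Fin 3) ℤ) : Matrix (Fin 3) (Fin 3) ℚ :=
  X.map fun a => (a : ℚ)

/-- The value of the quadratic form with Gram matrix `A` at an integral vector `x`. -/
def qf (A : Matrix (Fin 3) (Fin 3) ℚ) (x : Fin 3 → ℤ) : ℚ :=
  (fun i => (x i : ℚ)) ⬝ᵥ A.mulVec fun i => (x i : ℚ)

/-- A rational symmetric matrix is half-integral: integral diagonal, off-diagonal in (1/2)ℤ. -/
def HalfIntegral (A : Matrix (Fin 3) (Fin 3) ℚ) : Prop :=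
  (∀ i, ∃ n : ℤ, A i i = n) ∧ ∀ i j, ∃ n : ℤ, 2 * A i j = n

/-- `A` is symmetric and positive definite. -/
def PosDef3 (A : Matrix (Fin 3) (Fin 3) ℚ) : Prop :=
  A.IsSymm ∧ ∀ x : Fin 3 → ℚ, x ≠ 0 → 0 < x ⬝ᵥ A.mulVec x

/-- `r(K, L)`: the number of representations of the form with Gram matrix `A` by the form
with Gram matrix `B`. -/
def repNum (A B : Matrix (Fin 3) (Fin 3) ℚ) : ℕ :=
  Nat.card {X : Matrix (Fin 3) (Fin 3) ℤ // (intMap X)ᵀ * B * intMap X = A}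

/-- `o(L)`: the number of integral automorphs of the form with Gram matrix `A`. -/
def autNum (A : Matrix (Fin 3) (Fin 3) ℚ) : ℕ :=
  Nat.card {X : Matrix (Fin 3) (Fin 3) ℤ // IsUnit X.det ∧ (intMap X)ᵀ * A * intMap X = A}

/-- `r(n, f)`: the number of representations of the integer `n` by the form with
Gram matrix `A`. -/
def rEval (A : Matrix (Fin 3) (Fin 3) ℚ) (n : ℤ) : ℕ :=
  Nat.card {x : Fin 3 → ℤ // qf A x = (n : ℚ)}

/-- ℤ-equivalence of Gram matrices. -/
def ZEquiv (A B : Matrix (Fin 3) (Fin 3) ℚ) : Prop :=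
  ∃ X : Matrix (Fin 3) (Fin 3) ℤ, IsUnit X.det ∧ (intMap X)ᵀ * A * intMap X = B

/-- The Watson set `Λ_p(A) = {x ∈ ℤ³ : f_A(x + z) ≡ f_A(z) (mod p) for all z ∈ ℤ³}`. -/
def LamSet (p : ℕ) (A : Matrix (Fin 3) (Fin 3) ℚ) : Set (Fin 3 → ℤ) :=
  {x | ∀ z : Fin 3 → ℤ, ∃ k : ℤ, qf A (x + z) - qf A z = (p : ℚ) * k}

/-- ℤ_q-equivalence of rational Gram matrices (inside ℚ_q). -/
def ZqEquiv (q : ℕ) [Fact q.Prime] (A B : Matrix (Fin 3) (Fin 3) ℚ) : Prop :=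
  ∃ X : Matrix (Fin 3) (Fin 3) ℤ_[q], IsUnit X.det ∧
    (X.map fun a => (a : ℚ_[q]))ᵀ * A.map (fun a => (a : ℚ_[q])) * X.map (fun a => (a : ℚ_[q]))
      = B.map fun a => (a : ℚ_[q])

/-- ℤ_q-equivalence of a rational Gram matrix to a q-adic target matrix. -/
def ZpEquivTo (q : ℕ) [Fact q.Prime] (A : Matrix (Fin 3) (Fin 3) ℚ)
    (B : Matrix (Fin 3) (Fin 3) ℚ_[q]) : Prop :=
  ∃ X : Matrix (Fin 3) (Fin 3) ℤ_[q], IsUnit X.det ∧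
    (X.map fun a => (a : ℚ_[q]))ᵀ * A.map (fun a => (a : ℚ_[q])) * X.map (fun a => (a : ℚ_[q])) = B

/-- The block diagonal matrix `H ⊕ [c]` with `H = [[0,1/2],[1/2,0]]`. -/
def Hblock (q : ℕ) [Fact q.Prime] (c : ℚ_[q]) : Matrix (Fin 3) (Fin 3) ℚ_[q] :=
  !![0, 1/2, 0; 1/2, 0, 0; 0, 0, c]

/-! ### Integral matrices acting on rational Gram matrices -/

lemma intMap_mul (X Y : Matrix (Fin 3) (Fin 3) ℤ) : intMap (X * Y) = intMap X * intMap Y :=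
  Matrix.map_mul (f := Int.castRingHom ℚ)

lemma intMap_one : intMap 1 = 1 := by simp [intMap]

lemma intMap_smul (k : ℤ) (X : Matrix (Fin 3) (Fin 3) ℤ) :
    intMap (k • X) = (k : ℚ) • intMap X := by
  ext i j
  simp only [intMap, Matrix.map_apply, Matrix.smul_apply, smul_eq_mul, Int.cast_mul]

lemma intMap_det (X : Matrix (Fin 3) (Fin 3) ℤ) : (intMap X).det = (X.det : ℚ) :=
  ((Int.castRingHom ℚ).map_det X).symm

lemma intMap_mulVec (X : Matrix (Fin 3) (Fin 3) ℤ) (x : Fin 3 → ℤ) :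
    (fun i => ((X *ᵥ x) i : ℚ)) = intMap X *ᵥ fun i => (x i : ℚ) := by
  ext i; simp [intMap, Matrix.mulVec, dotProduct]

lemma qf_mulVec (A : Matrix (Fin 3) (Fin 3) ℚ) (X : Matrix (Fin 3) (Fin 3) ℤ) (x : Fin 3 → ℤ) :
    qf A (X *ᵥ x) = qf ((intMap X)ᵀ * A * intMap X) x := by
  unfold qf
  rw [intMap_mulVec, Matrix.mul_assoc, ← Matrix.mulVec_mulVec, ← Matrix.mulVec_mulVec,
    Matrix.dotProduct_mulVec _ (intMap X)ᵀ, Matrix.vecMul_transpose]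

lemma qf_single (A : Matrix (Fin 3) (Fin 3) ℚ) (i : Fin 3) : qf A (Pi.single i 1) = A i i := by
  fin_cases i <;> simp [qf, Matrix.mulVec, dotProduct, Pi.single_apply]

lemma qf_smul (A : Matrix (Fin 3) (Fin 3) ℚ) (k : ℤ) (x : Fin 3 → ℤ) :
    qf A (k • x) = (k : ℚ) ^ 2 * qf A x := by
  simp only [qf, Matrix.mulVec, dotProduct, Fin.sum_univ_three, Pi.smul_apply, smul_eq_mul,
    Int.cast_mul]
  ring

lemma congr_mul (A : Matrix (Fin 3) (Fin 3) ℚ) (X Y : Matrix (Fin 3) (Fin 3) ℤ) :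
    (intMap (X * Y))ᵀ * A * intMap (X * Y) =
      (intMap Y)ᵀ * ((intMap X)ᵀ * A * intMap X) * intMap Y := by
  simp only [intMap_mul, Matrix.transpose_mul, Matrix.mul_assoc]

lemma ZEquiv.symm {A B : Matrix (Fin 3) (Fin 3) ℚ} (h : ZEquiv A B) : ZEquiv B A := by
  obtain ⟨X, hX, rfl⟩ := h
  refine ⟨X⁻¹, ?_, ?_⟩
  · exact (Matrix.isUnit_nonsing_inv_det_iff).2 hX
  · rw [← congr_mul, Matrix.mul_nonsing_inv _ hX]
    simp [intMap_one]

lemma ZEquiv.trans {A B C : Matrix (Fin 3) (Fin 3) ℚ} (h : ZEquiv A B) (h' : ZEquiv B C) :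
    ZEquiv A C := by
  obtain ⟨X, hX, rfl⟩ := h
  obtain ⟨Y, hY, rfl⟩ := h'
  exact ⟨X * Y, by simpa using ⟨hX, hY⟩, congr_mul _ _ _⟩

lemma PosDef3.det_ne_zero {A : Matrix (Fin 3) (Fin 3) ℚ} (hA : PosDef3 A) : A.det ≠ 0 := by
  intro h
  obtain ⟨v, hv, hv0⟩ := Matrix.exists_mulVec_eq_zero_iff.2 h
  simpa [hv0] using hA.2 v hv

lemma PosDef3.congr {A : Matrix (Fin 3) (Fin 3) ℚ} (hA : PosDef3 A)
    {X : Matrix (Fin 3) (Fin 3) ℤ} (hX : X.det ≠ 0) :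
    PosDef3 ((intMap X)ᵀ * A * intMap X) := by
  refine ⟨?_, fun x hx => ?_⟩
  · simp only [Matrix.IsSymm, Matrix.transpose_mul, Matrix.transpose_transpose, hA.1.eq,
      Matrix.mul_assoc]
  · rw [Matrix.mul_assoc, ← Matrix.mulVec_mulVec, ← Matrix.mulVec_mulVec,
      Matrix.dotProduct_mulVec _ (intMap X)ᵀ, Matrix.vecMul_transpose]
    refine hA.2 _ fun h => ?_
    have h0 := Matrix.exists_mulVec_eq_zero_iff.1 ⟨x, hx, h⟩
    rw [intMap_det] at h0
    exact hX (by exact_mod_cast h0)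

lemma HalfIntegral.qf_int {A : Matrix (Fin 3) (Fin 3) ℚ} (hA : A.IsSymm) (h : HalfIntegral A)
    (x : Fin 3 → ℤ) : ∃ k : ℤ, qf A x = k := by
  choose d hd using h.1
  choose e he using h.2
  refine ⟨d 0 * x 0 ^ 2 + d 1 * x 1 ^ 2 + d 2 * x 2 ^ 2 + e 0 1 * x 0 * x 1 + e 0 2 * x 0 * x 2
    + e 1 2 * x 1 * x 2, ?_⟩
  push_cast
  simp only [← hd, ← he, qf, Matrix.mulVec, dotProduct, Fin.sum_univ_three]
  rw [hA.apply 0 1, hA.apply 0 2, hA.apply 1 2]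
  ring

/-- A symmetric rational matrix whose form is integral-valued is half-integral. -/
lemma halfIntegral_of_qf_int {A : Matrix (Fin 3) (Fin 3) ℚ} (hA : A.IsSymm)
    (h : ∀ x : Fin 3 → ℤ, ∃ k : ℤ, qf A x = k) : HalfIntegral A := by
  have he (i j : Fin 3) : qf A (Pi.single i 1 + Pi.single j 1) = A i i + A j j + 2 * A i j := by
    rw [show 2 * A i j = A i j + A j i by rw [hA.apply i j]; ring]
    simp only [qf, Matrix.mulVec, dotProduct, Fin.sum_univ_three]
    fin_cases i <;> fin_cases j <;> simp <;> ring
  refine ⟨fun i => qf_single A i ▸ h _, fun i j => ?_⟩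
  obtain ⟨a, ha⟩ := h (Pi.single i 1 + Pi.single j 1)
  obtain ⟨b, hb⟩ := h (Pi.single i 1)
  obtain ⟨c, hc⟩ := h (Pi.single j 1)
  rw [qf_single] at hb hc
  rw [he] at ha
  exact ⟨a - b - c, by push_cast; linarith⟩

/-! ### Finiteness of representation sets -/

lemma PosDef3.sq_le {A : Matrix (Fin 3) (Fin 3) ℚ} (hA : PosDef3 A) (i : Fin 3) :
    ∃ c : ℚ, ∀ x : Fin 3 → ℤ, (x i : ℚ) ^ 2 ≤ c * qf A x := by
  have hdet : IsUnit A.det := hA.det_ne_zero.isUnit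
  set u : Fin 3 → ℚ := A⁻¹ *ᵥ Pi.single i 1 with hu
  have hAu : A *ᵥ u = Pi.single i 1 := by
    rw [hu, Matrix.mulVec_mulVec, Matrix.mul_nonsing_inv _ hdet, Matrix.one_mulVec]
  have hu0 : u ≠ 0 := by
    intro h
    have := congrFun hAu i
    simp [h] at this
  have hpos := hA.2 u hu0
  have huu : u ⬝ᵥ A *ᵥ u = u i := by rw [hAu]; simp
  rw [huu] at hpos
  refine ⟨u i, fun x => ?_⟩
  set y : Fin 3 → ℚ := fun k => (x k : ℚ) with hy
  set z : Fin 3 → ℚ := u i • y - y i • u with hz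
  have h0 : 0 ≤ z ⬝ᵥ A *ᵥ z := by
    by_cases h : z = 0
    · simp [h]
    · exact (hA.2 z h).le
  have hyu : y ⬝ᵥ A *ᵥ u = y i := by rw [hAu]; simp
  have huy : u ⬝ᵥ A *ᵥ y = y i := by
    rw [Matrix.dotProduct_mulVec, ← Matrix.mulVec_transpose, hA.1.eq, hAu]; simp
  have hexp : z ⬝ᵥ A *ᵥ z = u i * (u i * qf A x - y i ^ 2) := by
    have : y ⬝ᵥ A *ᵥ y = qf A x := rfl
    rw [hz]
    simp only [Matrix.mulVec_sub, Matrix.mulVec_smul, sub_dotProduct, dotProduct_sub,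
      smul_dotProduct, dotProduct_smul, smul_eq_mul, hyu, huy, huu, this]
    ring
  rw [hexp] at h0
  have := nonneg_of_mul_nonneg_right h0 hpos
  change y i ^ 2 ≤ _
  linarith

lemma PosDef3.finite_qf_eq {A : Matrix (Fin 3) (Fin 3) ℚ} (hA : PosDef3 A) (r : ℚ) :
    {x : Fin 3 → ℤ | qf A x = r}.Finite := by
  choose c hc using hA.sq_le
  refine (Set.Finite.pi' fun i => Set.finite_Icc (-⌈|c i * r|⌉) ⌈|c i * r|⌉).subset ?_
  intro x hx i
  have h1 : (x i : ℚ) ^ 2 ≤ |c i * r| := by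
    have := hc i x
    rw [show qf A x = r from hx] at this
    exact this.trans (le_abs_self _)
  have h2 : (x i) ^ 2 ≤ ⌈|c i * r|⌉ := by
    have := h1.trans (Int.le_ceil _)
    exact_mod_cast this
  constructor <;> nlinarith

lemma PosDef3.finite_aut {A : Matrix (Fin 3) (Fin 3) ℚ} (hA : PosDef3 A) :
    {X : Matrix (Fin 3) (Fin 3) ℤ | IsUnit X.det ∧ (intMap X)ᵀ * A * intMap X = A}.Finite := by
  refine Set.Finite.of_finite_image (f := Matrix.transpose) ?_
    Matrix.transpose_injective.injOn
  refine (Set.Finite.pi' fun i => hA.finite_qf_eq (A i i)).subset ?_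
  rintro _ ⟨X, hX, rfl⟩ i
  change qf A (X.col i) = A i i
  rw [← Matrix.mulVec_single_one, qf_mulVec, hX.2, qf_single]

lemma autNum_pos {A : Matrix (Fin 3) (Fin 3) ℚ} (hA : PosDef3 A) : 0 < autNum A := by
  have : Finite {X : Matrix (Fin 3) (Fin 3) ℤ // IsUnit X.det ∧ (intMap X)ᵀ * A * intMap X = A} :=
    hA.finite_aut
  have : Nonempty {X : Matrix (Fin 3) (Fin 3) ℤ //
      IsUnit X.det ∧ (intMap X)ᵀ * A * intMap X = A} := ⟨1, by simp [intMap_one]⟩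
  exact Nat.card_pos

/-! ### Sublattices of `ℤ³` containing `pℤ³` -/

lemma exists_basis_matrix {p : ℤ} (hp : p ≠ 0) (S : Submodule ℤ (Fin 3 → ℤ))
    (hS : ∀ x, p • x ∈ S) :
    ∃ Y : Matrix (Fin 3) (Fin 3) ℤ, ∀ x, x ∈ S ↔ ∃ c, x = Y *ᵥ c := by
  have hrank : Module.finrank ℤ S = 3 := by
    refine le_antisymm (by simpa using S.finrank_le) ?_
    have := LinearMap.finrank_le_finrank_of_injective
      (f := ((LinearMap.lsmul ℤ (Fin 3 → ℤ) p).codRestrict S hS)) (by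
        intro x y h
        have h' := congrArg Subtype.val h
        exact smul_right_injective _ hp h')
    simpa using this
  let b := Module.finBasisOfFinrankEq ℤ S hrank
  have hb (c : Fin 3 → ℤ) : (Matrix.of fun i j => (b j : Fin 3 → ℤ) i) *ᵥ c
      = ((∑ j, c j • b j : S) : Fin 3 → ℤ) := by
    ext i
    simp [Matrix.mulVec, dotProduct, mul_comm, Fin.sum_univ_three]
  refine ⟨Matrix.of fun i j => (b j : Fin 3 → ℤ) i, fun x => ⟨fun hx => ?_, ?_⟩⟩
  · exact ⟨b.equivFun ⟨x, hx⟩, by rw [hb, b.sum_equivFun]⟩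
  · rintro ⟨c, rfl⟩
    rw [hb]
    exact Subtype.mem _

lemma exists_mul_eq_smul_one {p : ℤ} {Y : Matrix (Fin 3) (Fin 3) ℤ}
    (hY : ∀ x : Fin 3 → ℤ, ∃ c, p • x = Y *ᵥ c) :
    ∃ Y' : Matrix (Fin 3) (Fin 3) ℤ, Y * Y' = p • 1 := by
  choose c hc using hY
  refine ⟨Matrix.of fun i j => c (Pi.single j 1) i, ?_⟩
  ext i j
  have := congrFun (hc (Pi.single j 1)) i
  simp only [Matrix.mul_apply, Matrix.of_apply, Matrix.smul_apply, Matrix.one_apply]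
  rw [Pi.smul_apply] at this
  simp only [Matrix.mulVec, dotProduct] at this
  rw [← this]
  simp [Pi.single_apply]

lemma det_ne_zero_of_mul_eq_smul_one {R : Type*} [CommRing R] [IsDomain R] {p : R} (hp : p ≠ 0)
    {X Y : Matrix (Fin 3) (Fin 3) R} (h : X * Y = p • 1) : X.det ≠ 0 := by
  intro h0
  have h1 := congrArg Matrix.det h
  rw [Matrix.det_mul, h0, Matrix.det_smul, zero_mul, Matrix.det_one, mul_one] at h1
  exact pow_ne_zero _ hp h1.symm

lemma mul_left_cancel_of_det_ne_zero {R : Type*} [CommRing R] [IsDomain R]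
    {X Y Z : Matrix (Fin 3) (Fin 3) R} (hX : X.det ≠ 0) (h : X * Y = X * Z) : Y = Z := by
  have h1 := congrArg (X.adjugate * ·) h
  simp only [← Matrix.mul_assoc, Matrix.adjugate_mul, Matrix.smul_mul, Matrix.one_mul] at h1
  exact smul_right_injective _ hX h1

lemma mul_comm_of_mul_eq_smul_one {R : Type*} [CommRing R] [IsDomain R] {p : R} (hp : p ≠ 0)
    {X Y : Matrix (Fin 3) (Fin 3) R} (h : X * Y = p • 1) : Y * X = p • 1 := by
  refine mul_left_cancel_of_det_ne_zero (det_ne_zero_of_mul_eq_smul_one hp h) ?_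
  rw [← Matrix.mul_assoc, h]
  simp

lemma exists_eq_mul_of_mulVec {R : Type*} [CommRing R] {Y Z : Matrix (Fin 3) (Fin 3) R}
    (h : ∀ j, ∃ c, Z *ᵥ Pi.single j 1 = Y *ᵥ c) : ∃ X, Z = Y * X := by
  choose c hc using h
  refine ⟨Matrix.of fun i j => c j i, ?_⟩
  ext i j
  simpa [Matrix.mul_apply, Matrix.mulVec, dotProduct, Pi.single_apply] using congrFun (hc j) i

lemma exists_unit_of_range_eq {R : Type*} [CommRing R] [IsDomain R]
    {Y Z : Matrix (Fin 3) (Fin 3) R} (hY : Y.det ≠ 0)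
    (hZ : ∀ j, ∃ d, Z *ᵥ Pi.single j 1 = Y *ᵥ d) (hYZ : ∀ j, ∃ d, Y *ᵥ Pi.single j 1 = Z *ᵥ d) :
    ∃ X : Matrix (Fin 3) (Fin 3) R, IsUnit X.det ∧ Z = Y * X := by
  obtain ⟨X, hX⟩ := exists_eq_mul_of_mulVec hZ
  obtain ⟨X', hX'⟩ := exists_eq_mul_of_mulVec hYZ
  refine ⟨X, ?_, hX⟩
  have h1 : X * X' = 1 := by
    refine mul_left_cancel_of_det_ne_zero hY ?_
    rw [← Matrix.mul_assoc, ← hX, ← hX', Matrix.mul_one]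
  exact IsUnit.of_mul_eq_one X'.det (by rw [← Matrix.det_mul, h1, Matrix.det_one])

/-! ### Passing to `ℤ_p` and `𝔽_p` -/

section Padic

variable {p : ℕ} [Fact p.Prime]

/-- The image of an integral vector in `ℤ_p³`. -/
def padicVec (p : ℕ) [Fact p.Prime] (x : Fin 3 → ℤ) : Fin 3 → ℤ_[p] := fun i => (x i : ℤ_[p])

/-- The image of an integral matrix in the `p`-adic integral matrices. -/
def padicMat (p : ℕ) [Fact p.Prime] (X : Matrix (Fin 3) (Fin 3) ℤ) :
    Matrix (Fin 3) (Fin 3) ℤ_[p] := X.map fun a => (a : ℤ_[p])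

/-- The image of a `p`-adic integral matrix in the `p`-adic matrices. -/
def toQp (X : Matrix (Fin 3) (Fin 3) ℤ_[p]) : Matrix (Fin 3) (Fin 3) ℚ_[p] :=
  X.map fun a => (a : ℚ_[p])

/-- The image of a rational matrix in the `p`-adic matrices. -/
def ratToQp (p : ℕ) [Fact p.Prime] (A : Matrix (Fin 3) (Fin 3) ℚ) :
    Matrix (Fin 3) (Fin 3) ℚ_[p] :=
  A.map fun a => (a : ℚ_[p])

lemma padicMat_mul (X Y : Matrix (Fin 3) (Fin 3) ℤ) :
    padicMat p (X * Y) = padicMat p X * padicMat p Y :=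
  Matrix.map_mul (f := Int.castRingHom ℤ_[p])

lemma padicMat_smul_one (k : ℤ) : padicMat p (k • 1) = (k : ℤ_[p]) • 1 := by
  ext i j
  simp only [padicMat, Matrix.map_apply, Matrix.smul_apply, smul_eq_mul, Int.cast_mul,
    Matrix.one_apply]
  split_ifs <;> simp

lemma padicMat_mulVec (X : Matrix (Fin 3) (Fin 3) ℤ) (x : Fin 3 → ℤ) :
    padicVec p (X *ᵥ x) = padicMat p X *ᵥ padicVec p x := by
  ext i; simp [padicVec, padicMat, Matrix.mulVec, dotProduct]

lemma padicMat_mulVec_single (X : Matrix (Fin 3) (Fin 3) ℤ) (j : Fin 3) :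
    padicMat p X *ᵥ Pi.single j 1 = padicVec p (X *ᵥ Pi.single j 1) := by
  ext i; simp [padicVec, padicMat]

lemma toQp_mul (X Y : Matrix (Fin 3) (Fin 3) ℤ_[p]) : toQp (X * Y) = toQp X * toQp Y :=
  Matrix.map_mul (f := PadicInt.Coe.ringHom)

lemma toQp_one : toQp (1 : Matrix (Fin 3) (Fin 3) ℤ_[p]) = 1 :=
  Matrix.map_one _ PadicInt.coe_zero PadicInt.coe_one

lemma toQp_transpose (X : Matrix (Fin 3) (Fin 3) ℤ_[p]) : toQp Xᵀ = (toQp X)ᵀ := rfl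

lemma ratToQp_mul (X Y : Matrix (Fin 3) (Fin 3) ℚ) :
    ratToQp p (X * Y) = ratToQp p X * ratToQp p Y :=
  Matrix.map_mul (f := Rat.castHom ℚ_[p])

lemma ratToQp_transpose (X : Matrix (Fin 3) (Fin 3) ℚ) : ratToQp p Xᵀ = (ratToQp p X)ᵀ := rfl

lemma ratToQp_intMap (X : Matrix (Fin 3) (Fin 3) ℤ) :
    ratToQp p (intMap X) = toQp (padicMat p X) := by
  ext i j; simp [ratToQp, intMap, toQp, padicMat]

lemma ratToQp_smul (r : ℚ) (A : Matrix (Fin 3) (Fin 3) ℚ) :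
    ratToQp p (r • A) = (r : ℚ_[p]) • ratToQp p A := by
  ext i j; simp [ratToQp]

lemma ratToQp_congr (A : Matrix (Fin 3) (Fin 3) ℚ) (X : Matrix (Fin 3) (Fin 3) ℤ) :
    ratToQp p ((intMap X)ᵀ * A * intMap X) =
      (toQp (padicMat p X))ᵀ * ratToQp p A * toQp (padicMat p X) := by
  rw [ratToQp_mul, ratToQp_mul, ratToQp_transpose, ratToQp_intMap]

lemma toZMod_eq_zero_iff (a : ℤ_[p]) : PadicInt.toZMod a = 0 ↔ (p : ℤ_[p]) ∣ a := by
  rw [← RingHom.mem_ker, PadicInt.ker_toZMod, PadicInt.maximalIdeal_eq_span_p,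
    Ideal.mem_span_singleton]

lemma exists_padicVec_add (v : Fin 3 → ℤ_[p]) :
    ∃ (x : Fin 3 → ℤ) (w : Fin 3 → ℤ_[p]), v = padicVec p x + (p : ℤ_[p]) • w := by
  have h (i : Fin 3) : ∃ w, v i - ((v i).zmodRepr : ℤ_[p]) = p * w := by
    have := PadicInt.sub_zmodRepr_mem (v i)
    rwa [PadicInt.maximalIdeal_eq_span_p, Ideal.mem_span_singleton] at this
  choose w hw using h
  refine ⟨fun i => (v i).zmodRepr, w, ?_⟩
  ext i
  simp [padicVec, ← hw]

/-- The reduction modulo `p` of the coordinates `T x` of integral vectors `x`. -/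
def redHom (T : Matrix (Fin 3) (Fin 3) ℤ_[p]) : (Fin 3 → ℤ) →ₗ[ℤ] (Fin 3 → ZMod p) where
  toFun x i := PadicInt.toZMod ((T *ᵥ padicVec p x) i)
  map_add' x y := by
    have : padicVec p (x + y) = padicVec p x + padicVec p y := by ext i; simp [padicVec]
    ext i
    simp [this, Matrix.mulVec_add]
  map_smul' k x := by
    have : padicVec p (k • x) = (k : ℤ_[p]) • padicVec p x := by ext i; simp [padicVec]
    ext i
    rw [this, Matrix.mulVec_smul]
    simp

lemma redHom_apply (T : Matrix (Fin 3) (Fin 3) ℤ_[p]) (x : Fin 3 → ℤ) (i : Fin 3) :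
    redHom T x i = PadicInt.toZMod ((T *ᵥ padicVec p x) i) := rfl

lemma redHom_eq_zero_iff_dvd (T : Matrix (Fin 3) (Fin 3) ℤ_[p]) (x : Fin 3 → ℤ) (i : Fin 3) :
    redHom T x i = 0 ↔ (p : ℤ_[p]) ∣ (T *ᵥ padicVec p x) i := by
  rw [redHom_apply, toZMod_eq_zero_iff]

lemma redHom_surjective {T : Matrix (Fin 3) (Fin 3) ℤ_[p]} (hT : IsUnit T.det) :
    Function.Surjective (redHom T) := by
  intro w
  choose v hv using fun i => ZMod.ringHom_surjective (PadicInt.toZMod (p := p)) (w i)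
  obtain ⟨x, y, hxy⟩ := exists_padicVec_add (T⁻¹ *ᵥ v)
  refine ⟨x, ?_⟩
  have hx : T *ᵥ padicVec p x = v - (p : ℤ_[p]) • T *ᵥ y := by
    rw [← Matrix.mulVec_smul, eq_sub_iff_add_eq, ← Matrix.mulVec_add, ← hxy, Matrix.mulVec_mulVec,
      Matrix.mul_nonsing_inv _ hT, Matrix.one_mulVec]
  ext i
  simp [redHom_apply, hx, hv]

lemma redHom_eq_zero_iff {T : Matrix (Fin 3) (Fin 3) ℤ_[p]} (hT : IsUnit T.det) (x : Fin 3 → ℤ) :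
    redHom T x = 0 ↔ ∃ z, x = (p : ℤ) • z := by
  constructor
  · intro h
    have h1 (i : Fin 3) := (redHom_eq_zero_iff_dvd T x i).1 (congrFun h i)
    choose v hv using h1
    have h2 : padicVec p x = (p : ℤ_[p]) • T⁻¹ *ᵥ v := by
      rw [← Matrix.mulVec_smul, show (p : ℤ_[p]) • v = T *ᵥ padicVec p x from
        funext fun i => (hv i).symm, Matrix.mulVec_mulVec, Matrix.nonsing_inv_mul _ hT,
        Matrix.one_mulVec]
    have h3 (i : Fin 3) : (p : ℤ) ∣ x i := by
      have : (p : ℤ_[p]) ∣ (x i : ℤ_[p]) := ⟨_, congrFun h2 i⟩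
      rw [← toZMod_eq_zero_iff, map_intCast] at this
      exact (ZMod.intCast_zmod_eq_zero_iff_dvd _ _).1 this
    choose z hz using h3
    exact ⟨z, funext hz⟩
  · rintro ⟨z, rfl⟩
    rw [map_smul]
    ext i
    simp

/-- `A = Tᵀ (H ⊕ [c]) T` with `T ∈ GL₃(ℤ_p)`. -/
def IsLocalForm (A : Matrix (Fin 3) (Fin 3) ℚ) (c : ℤ_[p]) (T : Matrix (Fin 3) (Fin 3) ℤ_[p]) :
    Prop :=
  IsUnit T.det ∧ ratToQp p A = (toQp T)ᵀ * Hblock p (c : ℚ_[p]) * toQp T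

lemma Hblock_dotProduct (c : ℤ_[p]) (y : Fin 3 → ℤ_[p]) :
    (fun i => (y i : ℚ_[p])) ⬝ᵥ Hblock p (c : ℚ_[p]) *ᵥ (fun i => (y i : ℚ_[p])) =
      ((y 0 * y 1 + c * y 2 ^ 2 : ℤ_[p]) : ℚ_[p]) := by
  simp [Hblock, Matrix.mulVec, dotProduct, Fin.sum_univ_three]
  ring

lemma IsLocalForm.intCast_qf {A : Matrix (Fin 3) (Fin 3) ℚ} {c : ℤ_[p]}
    {T : Matrix (Fin 3) (Fin 3) ℤ_[p]} (h : IsLocalForm A c T) {x : Fin 3 → ℤ} {k : ℤ}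
    (hk : qf A x = k) :
    (k : ZMod p) = redHom T x 0 * redHom T x 1 + PadicInt.toZMod c * redHom T x 2 ^ 2 := by
  set y := T *ᵥ padicVec p x with hy
  have hyq : (fun i => (y i : ℚ_[p])) = toQp T *ᵥ fun i => (x i : ℚ_[p]) := by
    ext i; simp [hy, toQp, padicVec, Matrix.mulVec, dotProduct, Fin.sum_univ_three]
  have h1 : ((qf A x : ℚ) : ℚ_[p]) =
      (fun i => (x i : ℚ_[p])) ⬝ᵥ ratToQp p A *ᵥ (fun i => (x i : ℚ_[p])) := by
    simp [qf, ratToQp, Matrix.mulVec, dotProduct, Fin.sum_univ_three]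
  rw [h.2, Matrix.mul_assoc, ← Matrix.mulVec_mulVec, ← Matrix.mulVec_mulVec,
      Matrix.dotProduct_mulVec _ (toQp T)ᵀ, Matrix.vecMul_transpose, ← hyq, Hblock_dotProduct,
      hk] at h1
  have h2 : (k : ℤ_[p]) = y 0 * y 1 + c * y 2 ^ 2 := by
    apply PadicInt.ext
    rw [← h1]
    simp
  have h3 := congrArg PadicInt.toZMod h2
  rw [map_intCast, map_add, map_mul, map_mul, map_pow] at h3
  exact h3

lemma IsLocalForm.mem_LamSet_iff {A : Matrix (Fin 3) (Fin 3) ℚ} {c : ℤ_[p]}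
    {T : Matrix (Fin 3) (Fin 3) ℤ_[p]} (h : IsLocalForm A c T) (hc : (p : ℤ_[p]) ∣ c)
    (hA : A.IsSymm) (hA' : HalfIntegral A) (x : Fin 3 → ℤ) :
    x ∈ LamSet p A ↔ redHom T x 0 = 0 ∧ redHom T x 1 = 0 := by
  choose f hf using hA'.qf_int hA
  have hc0 : PadicInt.toZMod c = 0 := (toZMod_eq_zero_iff c).2 hc
  have hf' (z : Fin 3 → ℤ) : (f z : ZMod p) = redHom T z 0 * redHom T z 1 := by
    simpa [hc0] using h.intCast_qf (hf z)
  have h1 : x ∈ LamSet p A ↔ ∀ z, (f (x + z) : ZMod p) = f z := by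
    refine forall_congr' fun z => ?_
    rw [hf, hf, eq_comm, ZMod.intCast_eq_intCast_iff_dvd_sub]
    refine exists_congr fun k => ?_
    exact_mod_cast Iff.rfl
  simp only [h1, hf', map_add, Pi.add_apply]
  constructor
  · intro H
    have H' (w : Fin 3 → ZMod p) : (redHom T x 0 + w 0) * (redHom T x 1 + w 1) = w 0 * w 1 := by
      obtain ⟨z, rfl⟩ := redHom_surjective h.1 w
      exact H z
    have e0 := H' 0
    have e1 := H' (Pi.single 0 1)
    have e2 := H' (Pi.single 1 1)
    simp [-mul_eq_zero] at e0 e1 e2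
    exact ⟨by linear_combination e2 - e0, by linear_combination e1 - e0⟩
  · rintro ⟨h0, h1⟩ z
    simp [h0, h1]

lemma exists_diagonal_mul {T : Matrix (Fin 3) (Fin 3) ℤ_[p]} (hT : IsUnit T.det)
    {d d' : Fin 3 → ℤ_[p]} (hd : ∀ i, d i * d' i = p) {Y Y' : Matrix (Fin 3) (Fin 3) ℤ}
    (hYY' : Y * Y' = (p : ℤ) • 1)
    (h : ∀ x : Fin 3 → ℤ, (∃ c, x = Y *ᵥ c) ↔ ∀ i, d i ∣ (T *ᵥ padicVec p x) i) :
    ∃ S : Matrix (Fin 3) (Fin 3) ℤ_[p], IsUnit S.det ∧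
      T * padicMat p Y = Matrix.diagonal d * S := by
  have hp0 : (p : ℤ_[p]) ≠ 0 := by exact_mod_cast (Fact.out : p.Prime).ne_zero
  refine exists_unit_of_range_eq ?_ (fun j => ?_) (fun j => ?_)
  · rw [Matrix.det_diagonal]
    refine Finset.prod_ne_zero_iff.2 fun i _ h0 => hp0 ?_
    rw [← hd i, h0, zero_mul]
  · choose w hw using (h _).1 ⟨Pi.single j 1, rfl⟩
    refine ⟨w, ?_⟩
    rw [← Matrix.mulVec_mulVec, padicMat_mulVec_single]
    ext i
    rw [hw, Matrix.mulVec_diagonal]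
  · obtain ⟨x, w, hxw⟩ := exists_padicVec_add (T⁻¹ *ᵥ (Matrix.diagonal d *ᵥ Pi.single j 1))
    have hTx : Matrix.diagonal d *ᵥ Pi.single j 1 =
        T *ᵥ padicVec p x + (p : ℤ_[p]) • T *ᵥ w := by
      rw [← Matrix.mulVec_smul, ← Matrix.mulVec_add, ← hxw, Matrix.mulVec_mulVec,
        Matrix.mul_nonsing_inv _ hT, Matrix.one_mulVec]
    obtain ⟨c, rfl⟩ := (h x).2 fun i => by
      have hi := congrFun hTx i
      rw [Matrix.mulVec_diagonal, Pi.add_apply, Pi.smul_apply, smul_eq_mul, ← hd i] at hi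
      exact ⟨(Pi.single j 1 : Fin 3 → ℤ_[p]) i - d' i * (T *ᵥ w) i, by linear_combination -hi⟩
    refine ⟨padicVec p c + padicMat p Y' *ᵥ w, ?_⟩
    have hYw : padicMat p Y *ᵥ padicMat p Y' *ᵥ w = (p : ℤ_[p]) • w := by
      rw [Matrix.mulVec_mulVec, ← padicMat_mul, hYY', padicMat_smul_one]
      ext i
      simp [Matrix.smul_mulVec]
    rw [hTx, padicMat_mulVec, Matrix.mulVec_add, ← Matrix.mulVec_mulVec, ← Matrix.mulVec_mulVec,
      hYw, Matrix.mulVec_smul]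

lemma IsLocalForm.congr_diagonal {A : Matrix (Fin 3) (Fin 3) ℚ} {c : ℤ_[p]}
    {T S : Matrix (Fin 3) (Fin 3) ℤ_[p]} (h : IsLocalForm A c T) {d : Fin 3 → ℤ_[p]}
    {Y : Matrix (Fin 3) (Fin 3) ℤ} (hS : T * padicMat p Y = Matrix.diagonal d * S) :
    ratToQp p ((intMap Y)ᵀ * A * intMap Y) =
      (toQp S)ᵀ * (toQp (Matrix.diagonal d) * Hblock p (c : ℚ_[p]) * toQp (Matrix.diagonal d))
        * toQp S := by
  have h1 : toQp T * toQp (padicMat p Y) = toQp (Matrix.diagonal d) * toQp S := by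
    rw [← toQp_mul, hS, toQp_mul]
  have h2 : (toQp (padicMat p Y))ᵀ * (toQp T)ᵀ = (toQp S)ᵀ * toQp (Matrix.diagonal d) := by
    have := congrArg Matrix.transpose h1
    rw [Matrix.transpose_mul, Matrix.transpose_mul, ← toQp_transpose (Matrix.diagonal d),
      Matrix.diagonal_transpose] at this
    exact this
  rw [ratToQp_congr, h.2]
  calc _ = ((toQp (padicMat p Y))ᵀ * (toQp T)ᵀ) * Hblock p (c : ℚ_[p])
        * (toQp T * toQp (padicMat p Y)) := by simp only [Matrix.mul_assoc]
    _ = _ := by rw [h1, h2]; simp only [Matrix.mul_assoc]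

lemma ZpEquivTo.exists_isLocalForm {A : Matrix (Fin 3) (Fin 3) ℚ} {c : ℤ_[p]}
    (h : ZpEquivTo p A (Hblock p (c : ℚ_[p]))) : ∃ T, IsLocalForm A c T := by
  obtain ⟨X, hX, hXA⟩ := h
  have h1 : toQp X * toQp X⁻¹ = 1 := by rw [← toQp_mul, Matrix.mul_nonsing_inv _ hX, toQp_one]
  have h2 : (toQp X⁻¹)ᵀ * (toQp X)ᵀ = 1 := by
    rw [← Matrix.transpose_mul, h1, Matrix.transpose_one]
  refine ⟨X⁻¹, Matrix.isUnit_nonsing_inv_det_iff.2 hX, ?_⟩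
  rw [← hXA]
  change ratToQp p A = (toQp X⁻¹)ᵀ * ((toQp X)ᵀ * ratToQp p A * toQp X) * toQp X⁻¹
  calc ratToQp p A = ((toQp X⁻¹)ᵀ * (toQp X)ᵀ) * ratToQp p A * (toQp X * toQp X⁻¹) := by
        rw [h1, h2, Matrix.one_mul, Matrix.mul_one]
    _ = _ := by simp only [Matrix.mul_assoc]

lemma ZqEquiv.exists_isLocalForm {A B : Matrix (Fin 3) (Fin 3) ℚ} (h : ZqEquiv p A B)
    {c : ℤ_[p]} {T : Matrix (Fin 3) (Fin 3) ℤ_[p]} (hB : IsLocalForm B c T) :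
    ∃ S, IsLocalForm A c S := by
  obtain ⟨X, hX, hXA⟩ := h
  have h1 : toQp X * toQp X⁻¹ = 1 := by rw [← toQp_mul, Matrix.mul_nonsing_inv _ hX, toQp_one]
  have h2 : (toQp X⁻¹)ᵀ * (toQp X)ᵀ = 1 := by
    rw [← Matrix.transpose_mul, h1, Matrix.transpose_one]
  replace hXA : (toQp X)ᵀ * ratToQp p A * toQp X = ratToQp p B := hXA
  refine ⟨T * X⁻¹, ?_, ?_⟩
  · rw [Matrix.det_mul]
    exact hB.1.mul (Matrix.isUnit_nonsing_inv_det_iff.2 hX)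
  calc ratToQp p A = ((toQp X⁻¹)ᵀ * (toQp X)ᵀ) * ratToQp p A * (toQp X * toQp X⁻¹) := by
        rw [h1, h2, Matrix.one_mul, Matrix.mul_one]
    _ = (toQp X⁻¹)ᵀ * ((toQp X)ᵀ * ratToQp p A * toQp X) * toQp X⁻¹ := by
        simp only [Matrix.mul_assoc]
    _ = _ := by
        rw [hXA, hB.2, toQp_mul, Matrix.transpose_mul]
        simp only [Matrix.mul_assoc]

lemma IsLocalForm.zqEquiv {A B : Matrix (Fin 3) (Fin 3) ℚ} {c : ℤ_[p]}
    {S T : Matrix (Fin 3) (Fin 3) ℤ_[p]} (hA : IsLocalForm A c S) (hB : IsLocalForm B c T) :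
    ZqEquiv p A B := by
  have h1 : toQp S * toQp S⁻¹ = 1 := by rw [← toQp_mul, Matrix.mul_nonsing_inv _ hA.1, toQp_one]
  have h2 : (toQp S⁻¹)ᵀ * (toQp S)ᵀ = 1 := by
    rw [← Matrix.transpose_mul, h1, Matrix.transpose_one]
  refine ⟨S⁻¹ * T, ?_, ?_⟩
  · rw [Matrix.det_mul]
    exact (Matrix.isUnit_nonsing_inv_det_iff.2 hA.1).mul hB.1
  change (toQp (S⁻¹ * T))ᵀ * ratToQp p A * toQp (S⁻¹ * T) = ratToQp p B
  rw [hA.2, hB.2, toQp_mul, Matrix.transpose_mul]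
  calc _ = (toQp T)ᵀ * ((toQp S⁻¹)ᵀ * (toQp S)ᵀ) * Hblock p (c : ℚ_[p]) * (toQp S * toQp S⁻¹)
        * toQp T := by simp only [Matrix.mul_assoc]
    _ = _ := by rw [h1, h2, Matrix.mul_one, Matrix.mul_one]

lemma zqEquiv_of_ne {q : ℕ} [Fact q.Prime] (hqp : q ≠ p) {A B : Matrix (Fin 3) (Fin 3) ℚ}
    {W W' : Matrix (Fin 3) (Fin 3) ℤ} (hW : W * W' = ((p : ℤ) ^ 2) • 1)
    (h : (intMap W)ᵀ * A * intMap W = (p : ℚ) ^ 2 • B) : ZqEquiv q A B := by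
  have hpu : IsUnit (p : ℤ_[q]) := by
    rw [PadicInt.isUnit_iff]
    have : ¬ ‖((p : ℤ) : ℤ_[q])‖ < 1 := by
      rw [PadicInt.norm_int_lt_one_iff_dvd]
      intro hd
      exact hqp ((Nat.prime_dvd_prime_iff_eq Fact.out Fact.out).1 (by exact_mod_cast hd))
    exact le_antisymm (PadicInt.norm_le_one _) (not_lt.1 (by simpa using this))
  obtain ⟨u, hu⟩ := hpu
  have hu1 : ((↑u⁻¹ : ℤ_[q]) : ℚ_[q]) * (p : ℚ_[q]) = 1 := by
    have : (↑u⁻¹ : ℤ_[q]) * (p : ℤ_[q]) = 1 := by rw [← hu]; simp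
    exact_mod_cast congrArg (fun a : ℤ_[q] => (a : ℚ_[q])) this
  refine ⟨(↑u⁻¹ : ℤ_[q]) • padicMat q W, ?_, ?_⟩
  · rw [Matrix.det_smul]
    refine IsUnit.mul (Units.isUnit _ |>.pow _) ?_
    have h1 := congrArg Matrix.det (congrArg (padicMat q) hW)
    rw [padicMat_mul, padicMat_smul_one, Matrix.det_mul, Matrix.det_smul, Matrix.det_one, mul_one]
      at h1
    refine isUnit_of_mul_isUnit_left (y := (padicMat q W').det) ?_
    rw [h1]
    push_cast
    rw [← hu]
    exact ((Units.isUnit u).pow _).pow _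
  · have h1 := congrArg (ratToQp q) h
    rw [ratToQp_congr, ratToQp_smul] at h1
    have h2 : toQp ((↑u⁻¹ : ℤ_[q]) • padicMat q W) =
        ((↑u⁻¹ : ℤ_[q]) : ℚ_[q]) • toQp (padicMat q W) := by
      ext i j; simp [toQp]
    change (toQp ((↑u⁻¹ : ℤ_[q]) • padicMat q W))ᵀ * ratToQp q A *
      toQp ((↑u⁻¹ : ℤ_[q]) • padicMat q W) = ratToQp q B
    rw [h2, Matrix.transpose_smul, Matrix.smul_mul, Matrix.smul_mul, Matrix.mul_smul, h1,
      smul_smul, smul_smul]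
    push_cast
    rw [show ((↑u⁻¹ : ℤ_[q]) : ℚ_[q]) * ((↑u⁻¹ : ℤ_[q]) : ℚ_[q]) * (p : ℚ_[q]) ^ 2 = 1 by
      linear_combination (((↑u⁻¹ : ℤ_[q]) : ℚ_[q]) * (p : ℚ_[q]) + 1) * hu1, one_smul]

end Padic

/-! ### Frames: sublattices of `K` whose Watson transform is `K` -/

/-- `P` embeds the form `B` into `K` as a sublattice containing `pℤ³`, with complementary
matrix `P'`, such that `P'` is a basis matrix of the Watson lattice of `B`. -/
structure IsFrame (p : ℕ) (K B : Matrix (Fin 3) (Fin 3) ℚ) (P P' : Matrix (Fin 3) (Fin 3) ℤ) :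
    Prop where
  mul_eq : P * P' = (p : ℤ) • 1
  gram_eq : (intMap P)ᵀ * K * intMap P = B
  mem_LamSet_iff : ∀ y, y ∈ LamSet p B ↔ ∃ z, y = P' *ᵥ z

lemma mem_LamSet_congr_iff (p : ℕ) (A : Matrix (Fin 3) (Fin 3) ℚ)
    {X : Matrix (Fin 3) (Fin 3) ℤ} (hX : IsUnit X.det) (y : Fin 3 → ℤ) :
    y ∈ LamSet p ((intMap X)ᵀ * A * intMap X) ↔ X *ᵥ y ∈ LamSet p A := by
  simp only [LamSet, Set.mem_ofPred_eq, ← qf_mulVec, Matrix.mulVec_add]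
  refine ⟨fun h z => ?_, fun h z => h _⟩
  have := h (X⁻¹ *ᵥ z)
  rwa [Matrix.mulVec_mulVec, Matrix.mul_nonsing_inv _ hX, Matrix.one_mulVec] at this

lemma congr_injective {A B : Matrix (Fin 3) (Fin 3) ℚ} {P : Matrix (Fin 3) (Fin 3) ℤ}
    (hP : P.det ≠ 0) (h : (intMap P)ᵀ * A * intMap P = (intMap P)ᵀ * B * intMap P) : A = B := by
  have hu : IsUnit (intMap P).det := by
    rw [intMap_det]
    exact (by exact_mod_cast hP : (P.det : ℚ) ≠ 0).isUnit
  have hu' : IsUnit (intMap P)ᵀ.det := by rwa [Matrix.det_transpose]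
  have h1 := congrArg (fun M => ((intMap P)ᵀ)⁻¹ * (M * (intMap P)⁻¹)) h
  simpa only [Matrix.mul_nonsing_inv_cancel_right _ _ hu, Matrix.nonsing_inv_mul_cancel_left _ _ hu']
    using h1

namespace IsFrame

variable {p : ℕ} {K B : Matrix (Fin 3) (Fin 3) ℚ} {P P' Q Q' : Matrix (Fin 3) (Fin 3) ℤ}

lemma det_ne_zero (h : IsFrame p K B P P') (hp : p ≠ 0) : P.det ≠ 0 :=
  det_ne_zero_of_mul_eq_smul_one (by exact_mod_cast hp) h.mul_eq

lemma mul_eq' (h : IsFrame p K B P P') (hp : p ≠ 0) : P' * P = (p : ℤ) • 1 :=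
  mul_comm_of_mul_eq_smul_one (by exact_mod_cast hp) h.mul_eq

lemma det_ne_zero' (h : IsFrame p K B P P') (hp : p ≠ 0) : P'.det ≠ 0 :=
  det_ne_zero_of_mul_eq_smul_one (by exact_mod_cast hp) (h.mul_eq' hp)

lemma mulVec_injective (h : IsFrame p K B P P') (hp : p ≠ 0) :
    Function.Injective P.mulVec :=
  Matrix.mulVec_injective_of_det_ne_zero (h.det_ne_zero hp)

lemma aut_mul (h : IsFrame p K B P P') {X : Matrix (Fin 3) (Fin 3) ℤ} (hX : IsUnit X.det)
    (hXK : (intMap X)ᵀ * K * intMap X = K) : IsFrame p K B (X * P) (P' * X⁻¹) where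
  mul_eq := by
    rw [Matrix.mul_assoc, ← Matrix.mul_assoc P, h.mul_eq, Matrix.smul_mul, Matrix.one_mul,
      Matrix.mul_smul, Matrix.mul_nonsing_inv _ hX]
  gram_eq := by rw [congr_mul, hXK, h.gram_eq]
  mem_LamSet_iff y := by
    rw [h.mem_LamSet_iff]
    constructor
    · rintro ⟨z, rfl⟩
      exact ⟨X *ᵥ z, by
        rw [Matrix.mulVec_mulVec, Matrix.mul_assoc, Matrix.nonsing_inv_mul _ hX, Matrix.mul_one]⟩
    · rintro ⟨z, rfl⟩
      exact ⟨X⁻¹ *ᵥ z, by rw [Matrix.mulVec_mulVec]⟩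

lemma mul_unit (h : IsFrame p K B P P') {Z : Matrix (Fin 3) (Fin 3) ℤ} (hZ : IsUnit Z.det) :
    IsFrame p K ((intMap Z)ᵀ * B * intMap Z) (P * Z) (Z⁻¹ * P') where
  mul_eq := by
    rw [Matrix.mul_assoc, ← Matrix.mul_assoc Z, Matrix.mul_nonsing_inv _ hZ, Matrix.one_mul,
      h.mul_eq]
  gram_eq := by rw [congr_mul, h.gram_eq]
  mem_LamSet_iff y := by
    rw [mem_LamSet_congr_iff p B hZ, h.mem_LamSet_iff]
    refine exists_congr fun z => ⟨fun hz => ?_, fun hz => ?_⟩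
    · rw [← Matrix.mulVec_mulVec, ← hz, Matrix.mulVec_mulVec, Matrix.nonsing_inv_mul _ hZ,
        Matrix.one_mulVec]
    · rw [hz, Matrix.mulVec_mulVec, ← Matrix.mul_assoc, Matrix.mul_nonsing_inv _ hZ,
        Matrix.one_mul]

lemma exists_aut_mul_eq (hp : p ≠ 0) (h : IsFrame p K B P P') (h' : IsFrame p K B Q Q') :
    ∃ X : Matrix (Fin 3) (Fin 3) ℤ, (IsUnit X.det ∧ (intMap X)ᵀ * K * intMap X = K) ∧
      X * P = Q := by
  obtain ⟨X, hX, hPX⟩ := exists_unit_of_range_eq (h'.det_ne_zero' hp)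
    (fun j => (h'.mem_LamSet_iff _).1 ((h.mem_LamSet_iff _).2 ⟨Pi.single j 1, rfl⟩))
    (fun j => (h.mem_LamSet_iff _).1 ((h'.mem_LamSet_iff _).2 ⟨Pi.single j 1, rfl⟩))
  have hXP : X * P = Q := by
    have h1 : (p : ℤ) • (X * P) = (p : ℤ) • Q := by
      calc (p : ℤ) • (X * P) = Q * Q' * (X * P) := by rw [h'.mul_eq, Matrix.smul_mul, Matrix.one_mul]
        _ = Q * (Q' * X * P) := by simp only [Matrix.mul_assoc]
        _ = (p : ℤ) • Q := by rw [← hPX, h.mul_eq' hp, Matrix.mul_smul, Matrix.mul_one]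
    exact smul_right_injective _ (by exact_mod_cast hp) h1
  refine ⟨X, ⟨hX, congr_injective (h.det_ne_zero hp) ?_⟩, hXP⟩
  rw [← congr_mul, hXP, h.gram_eq, h'.gram_eq]

lemma exists_mul_unit_eq (hp : p ≠ 0) {C : Matrix (Fin 3) (Fin 3) ℚ} (h : IsFrame p K B P P')
    (h' : IsFrame p K C Q Q') (hPQ : Set.range P.mulVec = Set.range Q.mulVec) :
    ∃ Z : Matrix (Fin 3) (Fin 3) ℤ, (IsUnit Z.det ∧ (intMap Z)ᵀ * B * intMap Z = C) ∧
      P * Z = Q := by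
  have hQ (c) : ∃ d, Q *ᵥ c = P *ᵥ d := by
    obtain ⟨d, hd⟩ : Q *ᵥ c ∈ Set.range P.mulVec := hPQ ▸ ⟨c, rfl⟩
    exact ⟨d, hd.symm⟩
  have hP (c) : ∃ d, P *ᵥ c = Q *ᵥ d := by
    obtain ⟨d, hd⟩ : P *ᵥ c ∈ Set.range Q.mulVec := hPQ ▸ ⟨c, rfl⟩
    exact ⟨d, hd.symm⟩
  obtain ⟨Z, hZ, hPZ⟩ := exists_unit_of_range_eq (h.det_ne_zero hp) (fun j => hQ (Pi.single j 1))
    (fun j => hP (Pi.single j 1))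
  exact ⟨Z, ⟨hZ, by rw [← h'.gram_eq, hPZ, congr_mul, h.gram_eq]⟩, hPZ.symm⟩

lemma range_mul_unit {Z : Matrix (Fin 3) (Fin 3) ℤ} (hZ : IsUnit Z.det) :
    Set.range (P * Z).mulVec = Set.range P.mulVec := by
  ext x
  constructor
  · rintro ⟨c, rfl⟩
    exact ⟨Z *ᵥ c, Matrix.mulVec_mulVec _ _ _⟩
  · rintro ⟨c, rfl⟩
    exact ⟨Z⁻¹ *ᵥ c, by
      rw [Matrix.mulVec_mulVec, Matrix.mul_assoc, Matrix.mul_nonsing_inv _ hZ, Matrix.mul_one]⟩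

lemma card_eq_autNum (hp : p ≠ 0) (h : IsFrame p K B P P') :
    Nat.card {Q // ∃ Q', IsFrame p K B Q Q'} = autNum K := by
  refine (Nat.card_eq_of_bijective (fun X => ⟨X.1 * P, _, h.aut_mul X.2.1 X.2.2⟩) ⟨?_, ?_⟩).symm
  · rintro ⟨X, _⟩ ⟨Y, _⟩ hXY
    have h1 : X * P = Y * P := congrArg Subtype.val hXY
    have h2 := congrArg Matrix.transpose h1
    rw [Matrix.transpose_mul, Matrix.transpose_mul] at h2
    exact Subtype.ext (Matrix.transpose_injective (mul_left_cancel_of_det_ne_zero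
      (by simpa using h.det_ne_zero hp) h2))
  · rintro ⟨Q, Q', h'⟩
    obtain ⟨X, hX, hXP⟩ := h.exists_aut_mul_eq hp h'
    exact ⟨⟨X, hX⟩, Subtype.ext hXP⟩

lemma card_range_eq_autNum (hp : p ≠ 0) (h : IsFrame p K B P P') :
    Nat.card {Q : {Q // ∃ Q', IsFrame p K B Q Q'} //
      Set.range Q.1.mulVec = Set.range P.mulVec} = autNum B := by
  refine (Nat.card_eq_of_bijective (fun Z => ⟨⟨P * Z.1, Z.1⁻¹ * P', ?_⟩, ?_⟩) ⟨?_, ?_⟩).symm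
  rotate_left 2
  · have := h.mul_unit Z.2.1
    rwa [Z.2.2] at this
  · exact range_mul_unit Z.2.1
  · rintro ⟨X, _⟩ ⟨Y, _⟩ hXY
    have h1 : P * X = P * Y := congrArg (fun R => R.1.1) hXY
    exact Subtype.ext (mul_left_cancel_of_det_ne_zero (h.det_ne_zero hp) h1)
  · rintro ⟨⟨Q, Q', h'⟩, hQ⟩
    obtain ⟨Z, hZ, hPZ⟩ := h.exists_mul_unit_eq hp h' hQ.symm
    exact ⟨⟨Z, hZ⟩, Subtype.ext (Subtype.ext hPZ)⟩

lemma rEval_eq (hp : p ≠ 0) (h : IsFrame p K B P P') (n : ℤ) :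
    rEval B n = Nat.card {x // x ∈ Set.range P.mulVec ∧ qf K x = n} := by
  refine Nat.card_eq_of_bijective
    (fun y => ⟨P *ᵥ y.1, ⟨_, rfl⟩, by rw [qf_mulVec, h.gram_eq, y.2]⟩) ⟨?_, ?_⟩
  · rintro ⟨x, _⟩ ⟨y, _⟩ hxy
    exact Subtype.ext (h.mulVec_injective hp (congrArg Subtype.val hxy))
  · rintro ⟨_, ⟨y, rfl⟩, hy⟩
    exact ⟨⟨y, by rwa [qf_mulVec, h.gram_eq] at hy⟩, rfl⟩

end IsFrame

open Classical in
/-- If every sublattice `M j` is spanned by a frame of a unique `Ls i`, the weighted representation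
numbers of the `Ls i` are computed by the `M j`. -/
theorem sum_rEval_div_autNum {p : ℕ} (hp : p ≠ 0) {K : Matrix (Fin 3) (Fin 3) ℚ} (hK : PosDef3 K)
    {ι J : Type*} [Fintype ι] [Fintype J] {Ls : ι → Matrix (Fin 3) (Fin 3) ℚ}
    (hLs : ∀ i, PosDef3 (Ls i)) (hne : ∀ i j, i ≠ j → ¬ ZEquiv (Ls i) (Ls j))
    {M : J → Set (Fin 3 → ℤ)} (hM : Function.Injective M)
    (hex : ∀ i, ∃ P P', IsFrame p K (Ls i) P P')
    (hframe : ∀ i P P', IsFrame p K (Ls i) P P' → ∃ j, Set.range P.mulVec = M j)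
    (hlat : ∀ j, ∃ i P P', IsFrame p K (Ls i) P P' ∧ Set.range P.mulVec = M j) (n : ℤ) :
    ∑ i, (rEval (Ls i) n : ℚ) / (autNum (Ls i) : ℚ) =
      (∑ j, (Nat.card {x // x ∈ M j ∧ qf K x = n} : ℚ)) / (autNum K : ℚ) := by
  choose cl P P' hP hPM using hlat
  have hcl (i j Q Q') (hQ : IsFrame p K (Ls i) Q Q') (hQj : Set.range Q.mulVec = M j) :
      cl j = i := by
    by_contra hij
    obtain ⟨Z, hZ, -⟩ := (hP j).exists_mul_unit_eq hp hQ ((hPM j).trans hQj.symm)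
    exact hne _ _ hij ⟨Z, hZ⟩
  have hcard (i) : autNum K = Fintype.card {j // cl j = i} * autNum (Ls i) := by
    obtain ⟨Q₀, Q₀', hQ₀⟩ := hex i
    rw [← hQ₀.card_eq_autNum hp]
    choose idx hidx using fun Q : {Q // ∃ Q', IsFrame p K (Ls i) Q Q'} =>
      hframe i Q.1 Q.2.choose Q.2.choose_spec
    let f (Q : {Q // ∃ Q', IsFrame p K (Ls i) Q Q'}) : {j // cl j = i} :=
      ⟨idx Q, hcl i _ _ _ Q.2.choose_spec (hidx Q)⟩
    have : Finite {Q // ∃ Q', IsFrame p K (Ls i) Q Q'} :=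
      Nat.finite_of_card_ne_zero (by rw [hQ₀.card_eq_autNum hp]; exact (autNum_pos hK).ne')
    rw [← Nat.card_congr (Equiv.sigmaFiberEquiv f), Nat.card_sigma]
    have hfib (j : {j // cl j = i}) : Nat.card {Q // f Q = j} = autNum (Ls i) := by
      obtain ⟨j, rfl⟩ := j
      rw [← (hP j).card_range_eq_autNum hp]
      refine Nat.card_congr (Equiv.subtypeEquivRight fun Q => ?_)
      rw [hPM, hidx, hM.eq_iff, Subtype.ext_iff]
    simp [hfib]
  rw [Finset.sum_div, ← Finset.sum_fiberwise (g := cl)]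
  refine Finset.sum_congr rfl fun i _ => ?_
  have hN (j) (hj : j ∈ Finset.univ.filter (fun j => cl j = i)) :
      (Nat.card {x // x ∈ M j ∧ qf K x = n} : ℚ) / (autNum K : ℚ) =
        (rEval (Ls i) n : ℚ) / (autNum K : ℚ) := by
    obtain rfl : cl j = i := (Finset.mem_filter.1 hj).2
    rw [(hP j).rEval_eq hp, hPM]
  rw [Finset.sum_congr rfl hN, Finset.sum_const, ← Fintype.card_subtype, nsmul_eq_mul]
  have hK0 : (autNum K : ℚ) ≠ 0 := by exact_mod_cast (autNum_pos hK).ne'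
  have hL0 : (autNum (Ls i) : ℚ) ≠ 0 := by exact_mod_cast (autNum_pos (hLs i)).ne'
  have hc : (autNum K : ℚ) = Fintype.card {j // cl j = i} * autNum (Ls i) := by
    exact_mod_cast hcard i
  rw [← mul_div_assoc, div_eq_div_iff hL0 hK0, hc]
  ring

/-! ### Local structure of frames at `p` -/

section LocalFrames

variable {p : ℕ} [Fact p.Prime]

lemma toQp_diagonal (d : Fin 3 → ℤ_[p]) :
    toQp (Matrix.diagonal d) = Matrix.diagonal fun i => (d i : ℚ_[p]) :=
  Matrix.diagonal_map PadicInt.coe_zero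

lemma diagonal_mul_Hblock_mul_diagonal (a b : ℤ_[p]) (c : ℚ_[p]) :
    toQp (Matrix.diagonal ![a, a, b]) * Hblock p c * toQp (Matrix.diagonal ![a, a, b]) =
      !![0, (a : ℚ_[p]) ^ 2 / 2, 0; (a : ℚ_[p]) ^ 2 / 2, 0, 0; 0, 0, (b : ℚ_[p]) ^ 2 * c] := by
  rw [toQp_diagonal]
  ext i j
  fin_cases i <;> fin_cases j <;> simp [Hblock, Matrix.diagonal_mul, Matrix.mul_diagonal] <;> ring

/-- The Watson transform of a form `H ⊕ [p²c]` is of the shape `H ⊕ [c]` at `p`. -/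
lemma IsLocalForm.exists_watson {L K : Matrix (Fin 3) (Fin 3) ℚ} {c : ℤ_[p]}
    {V : Matrix (Fin 3) (Fin 3) ℤ_[p]} (hV : IsLocalForm L ((p : ℤ_[p]) ^ 2 * c) V)
    (hL : L.IsSymm) (hLh : HalfIntegral L) {Y Y' : Matrix (Fin 3) (Fin 3) ℤ}
    (hYY' : Y * Y' = (p : ℤ) • 1) (hY : ∀ x, x ∈ LamSet p L ↔ ∃ c, x = Y *ᵥ c)
    (hK : (intMap Y)ᵀ * L * intMap Y = (p : ℚ) ^ 2 • K) : ∃ U, IsLocalForm K c U := by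
  have hdvd : (p : ℤ_[p]) ∣ (p : ℤ_[p]) ^ 2 * c := (dvd_pow_self _ two_ne_zero).mul_right c
  obtain ⟨U, hU, hVU⟩ := exists_diagonal_mul hV.1 (d := ![(p : ℤ_[p]), p, 1]) (d' := ![1, 1, p])
    (by intro i; fin_cases i <;> simp) hYY' fun x => by
      rw [← hY, hV.mem_LamSet_iff hdvd hL hLh, redHom_eq_zero_iff_dvd, redHom_eq_zero_iff_dvd,
        Fin.forall_fin_succ, Fin.forall_fin_two]
      simp
  refine ⟨U, hU, ?_⟩
  have h1 := hV.congr_diagonal hVU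
  have hp2 : (p : ℚ_[p]) ^ 2 ≠ 0 := pow_ne_zero _ (by exact_mod_cast (Fact.out : p.Prime).ne_zero)
  have h2 : toQp (Matrix.diagonal ![(p : ℤ_[p]), p, 1]) *
      Hblock p (((p : ℤ_[p]) ^ 2 * c : ℤ_[p]) : ℚ_[p]) *
        toQp (Matrix.diagonal ![(p : ℤ_[p]), p, 1]) = (p : ℚ_[p]) ^ 2 • Hblock p (c : ℚ_[p]) := by
    rw [diagonal_mul_Hblock_mul_diagonal]
    ext i j
    fin_cases i <;> fin_cases j <;> simp [Hblock] <;> ring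
  rw [hK, ratToQp_smul, h2, Matrix.mul_smul, Matrix.smul_mul] at h1
  push_cast at h1
  exact smul_right_injective _ hp2 h1

/-- A form whose Watson transform is equivalent to `K` admits a frame in `K`. -/
lemma exists_isFrame {B K : Matrix (Fin 3) (Fin 3) ℚ} {c : ℤ_[p]}
    {T : Matrix (Fin 3) (Fin 3) ℤ_[p]} (hT : IsLocalForm B c T) (hc : (p : ℤ_[p]) ∣ c)
    (hB : B.IsSymm) (hBh : HalfIntegral B)
    (hlam : ∀ Y : Matrix (Fin 3) (Fin 3) ℤ, (∀ x, x ∈ LamSet p B ↔ ∃ c, x = Y *ᵥ c) →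
      ZEquiv (((p : ℚ) ^ 2)⁻¹ • ((intMap Y)ᵀ * B * intMap Y)) K) :
    ∃ P P', IsFrame p K B P P' := by
  have hp0 : (p : ℤ) ≠ 0 := by exact_mod_cast (Fact.out : p.Prime).ne_zero
  have hp2 : (p : ℚ) ^ 2 ≠ 0 := pow_ne_zero _ (by exact_mod_cast (Fact.out : p.Prime).ne_zero)
  let S : Submodule ℤ (Fin 3 → ℤ) :=
    LinearMap.ker (LinearMap.proj 0 ∘ₗ redHom T) ⊓ LinearMap.ker (LinearMap.proj 1 ∘ₗ redHom T)
  have hS (x) : x ∈ S ↔ x ∈ LamSet p B := by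
    rw [hT.mem_LamSet_iff hc hB hBh]; rfl
  have hpS (x) : (p : ℤ) • x ∈ S := by
    have := (redHom_eq_zero_iff hT.1 ((p : ℤ) • x)).2 ⟨x, rfl⟩
    exact ⟨congrFun this 0, congrFun this 1⟩
  obtain ⟨Y, hY⟩ := exists_basis_matrix hp0 S hpS
  obtain ⟨X, hX, hXK⟩ := hlam Y fun x => by rw [← hS, hY]
  obtain ⟨P, hP⟩ := exists_mul_eq_smul_one (Y := Y * X) (p := p) fun x => by
    obtain ⟨c, hc⟩ := (hY _).1 (hpS x)
    exact ⟨X⁻¹ *ᵥ c, by rw [Matrix.mulVec_mulVec, Matrix.mul_assoc, Matrix.mul_nonsing_inv _ hX,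
      Matrix.mul_one, hc]⟩
  refine ⟨P, Y * X, mul_comm_of_mul_eq_smul_one hp0 hP, ?_, fun y => ?_⟩
  · rw [← hXK, Matrix.mul_smul, Matrix.smul_mul, ← congr_mul, Matrix.mul_smul, Matrix.smul_mul,
      ← congr_mul, hP, intMap_smul, intMap_one]
    simp [smul_smul]
    field_simp
    simp
  · rw [← hS, hY]
    constructor
    · rintro ⟨c, rfl⟩
      exact ⟨X⁻¹ *ᵥ c, by rw [Matrix.mulVec_mulVec, Matrix.mul_assoc, Matrix.mul_nonsing_inv _ hX,
        Matrix.mul_one]⟩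
    · rintro ⟨c, rfl⟩
      exact ⟨X *ᵥ c, by rw [Matrix.mulVec_mulVec]⟩

/-- The sublattice of `K ≅ H ⊕ [c]` where the last coordinate vanishes modulo `p` is spanned by a
frame of a form which is `H ⊕ [p²c]` at `p`. -/
lemma IsLocalForm.exists_isFrame_range_eq {K : Matrix (Fin 3) (Fin 3) ℚ} {c : ℤ_[p]}
    {U : Matrix (Fin 3) (Fin 3) ℤ_[p]} (hU : IsLocalForm K c U) (hK : PosDef3 K)
    (hKh : HalfIntegral K) :
    ∃ A P P', IsFrame p K A P P' ∧ Set.range P.mulVec = {x | redHom U x 2 = 0} ∧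
      PosDef3 A ∧ HalfIntegral A ∧ ∃ S, IsLocalForm A ((p : ℤ_[p]) ^ 2 * c) S := by
  have hp0 : (p : ℤ) ≠ 0 := by exact_mod_cast (Fact.out : p.Prime).ne_zero
  have hdvd : (p : ℤ_[p]) ∣ (p : ℤ_[p]) ^ 2 * c := (dvd_pow_self _ two_ne_zero).mul_right c
  let M : Submodule ℤ (Fin 3 → ℤ) := LinearMap.ker (LinearMap.proj 2 ∘ₗ redHom U)
  have hpM (x) : (p : ℤ) • x ∈ M :=
    congrFun ((redHom_eq_zero_iff hU.1 ((p : ℤ) • x)).2 ⟨x, rfl⟩) 2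
  obtain ⟨P, hP⟩ := exists_basis_matrix hp0 M hpM
  obtain ⟨P', hPP'⟩ := exists_mul_eq_smul_one fun x => (hP _).1 (hpM x)
  have hdet : P.det ≠ 0 := det_ne_zero_of_mul_eq_smul_one hp0 hPP'
  have hmem (x) : (∃ c, x = P *ᵥ c) ↔ redHom U x 2 = 0 := (hP x).symm
  obtain ⟨S, hS, hUS⟩ := exists_diagonal_mul hU.1 (d := ![1, 1, (p : ℤ_[p])]) (d' := ![p, p, 1])
    (by intro i; fin_cases i <;> simp) hPP' fun x => by
      rw [hmem, redHom_eq_zero_iff_dvd, Fin.forall_fin_succ, Fin.forall_fin_two]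
      simp
  set A := (intMap P)ᵀ * K * intMap P with hA
  have hAK : PosDef3 A := hK.congr hdet
  have hAh : HalfIntegral A := halfIntegral_of_qf_int hAK.1 fun x => by
    rw [hA, ← qf_mulVec]
    exact hKh.qf_int hK.1 _
  have hAS : IsLocalForm A ((p : ℤ_[p]) ^ 2 * c) S := by
    refine ⟨hS, ?_⟩
    rw [hU.congr_diagonal hUS, diagonal_mul_Hblock_mul_diagonal]
    simp [Hblock]
  refine ⟨A, P, P', ⟨hPP', rfl, fun y => ?_⟩, ?_, hAK, hAh, S, hAS⟩
  · have h1 : redHom U (P *ᵥ y) = 0 ↔ redHom S y 0 = 0 ∧ redHom S y 1 = 0 := by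
      rw [funext_iff, Fin.forall_fin_succ, Fin.forall_fin_two]
      simp only [redHom_apply, padicMat_mulVec, Matrix.mulVec_mulVec, hUS]
      simp [← Matrix.mulVec_mulVec, Matrix.mulVec_diagonal]
    rw [hAS.mem_LamSet_iff hdvd hAK.1 hAh, ← h1, redHom_eq_zero_iff hU.1]
    refine exists_congr fun z => ?_
    have h2 : (p : ℤ) • z = P *ᵥ P' *ᵥ z := by
      rw [Matrix.mulVec_mulVec, hPP', Matrix.smul_mulVec, Matrix.one_mulVec]
    rw [h2, (Matrix.mulVec_injective_of_det_ne_zero hdet).eq_iff]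
  · ext x
    rw [Set.mem_ofPred_eq, ← hmem]
    exact exists_congr fun _ => eq_comm

lemma exists_eq_add_of_dotProduct_eq_zero {F : Type*} [Field F] {c : F} {u v w l : Fin 3 → F}
    (hu : u 0 * u 1 + c * u 2 ^ 2 = 0) (hv : v 0 * v 1 + c * v 2 ^ 2 = 0)
    (huv : (u + v) 0 * (u + v) 1 + c * (u + v) 2 ^ 2 = 1)
    (hl : l ≠ 0) (hlu : l ⬝ᵥ u = 0) (hlv : l ⬝ᵥ v = 0) (hlw : l ⬝ᵥ w = 0) :
    ∃ a b : F, w = a • u + b • v := by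
  have hdet : (Matrix.of ![u, v, w]).det = 0 := by
    refine Matrix.exists_mulVec_eq_zero_iff.1 ⟨l, hl, ?_⟩
    ext i
    fin_cases i
    exacts [(dotProduct_comm u l).trans hlu, (dotProduct_comm v l).trans hlv,
      (dotProduct_comm w l).trans hlw]
  obtain ⟨k, hk, hk0⟩ := Matrix.exists_vecMul_eq_zero_iff.2 hdet
  have hsum (i : Fin 3) : k 0 * u i + k 1 * v i + k 2 * w i = 0 := by
    have := congrFun hk0 i
    simpa [Matrix.vecMul, dotProduct, Fin.sum_univ_three] using this
  simp only [Pi.add_apply] at huv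
  have hB : u 0 * v 1 + u 1 * v 0 + 2 * c * u 2 * v 2 = 1 := by linear_combination huv - hu - hv
  have hk2 : k 2 ≠ 0 := by
    intro h
    have e (i : Fin 3) : k 0 * u i + k 1 * v i = 0 := by simpa [h] using hsum i
    have h0 : k 0 = 0 := by
      linear_combination -k 0 * hB + v 1 * e 0 + v 0 * e 1 + 2 * c * v 2 * e 2 - 2 * k 1 * hv
    have h1 : k 1 = 0 := by
      linear_combination -k 1 * hB + u 1 * e 0 + u 0 * e 1 + 2 * c * u 2 * e 2 - 2 * k 0 * hu
    exact hk (funext fun i => by fin_cases i <;> assumption)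
  refine ⟨-(k 0 / k 2), -(k 1 / k 2), funext fun i => ?_⟩
  simp only [Pi.add_apply, Pi.smul_apply, smul_eq_mul]
  field_simp
  linear_combination hsum i

/-- The lattice of a frame reduces modulo `p` to a hyperbolic plane. -/
lemma IsFrame.exists_hyperbolic_pair {K B : Matrix (Fin 3) (Fin 3) ℚ}
    {P P' : Matrix (Fin 3) (Fin 3) ℤ} (h : IsFrame p K B P P') {c c' : ℤ_[p]}
    {T U : Matrix (Fin 3) (Fin 3) ℤ_[p]} (hT : IsLocalForm B c' T) (hc' : (p : ℤ_[p]) ∣ c')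
    (hU : IsLocalForm K c U) (hK : K.IsSymm) (hKh : HalfIntegral K) (hB : B.IsSymm)
    (hBh : HalfIntegral B) :
    ∃ u v : Fin 3 → ZMod p, u 0 * u 1 + PadicInt.toZMod c * u 2 ^ 2 = 0 ∧
      v 0 * v 1 + PadicInt.toZMod c * v 2 ^ 2 = 0 ∧
      (u + v) 0 * (u + v) 1 + PadicInt.toZMod c * (u + v) 2 ^ 2 = 1 ∧
      ∀ l : Fin 3 → ZMod p, l ≠ 0 → l ⬝ᵥ u = 0 → l ⬝ᵥ v = 0 →
        Set.range P.mulVec = {x | l ⬝ᵥ redHom U x = 0} := by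
  obtain ⟨y, hy⟩ := redHom_surjective hT.1 (Pi.single 0 1)
  obtain ⟨z, hz⟩ := redHom_surjective hT.1 (Pi.single 1 1)
  have hval (x : Fin 3 → ℤ) : redHom U (P *ᵥ x) 0 * redHom U (P *ᵥ x) 1 +
      PadicInt.toZMod c * redHom U (P *ᵥ x) 2 ^ 2 = redHom T x 0 * redHom T x 1 := by
    obtain ⟨k, hk⟩ := hKh.qf_int hK (P *ᵥ x)
    have hk' := hk
    rw [qf_mulVec, h.gram_eq] at hk'
    rw [← hU.intCast_qf hk, hT.intCast_qf hk', (toZMod_eq_zero_iff c').2 hc']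
    ring
  have hadd : redHom U (P *ᵥ y) + redHom U (P *ᵥ z) = redHom U (P *ᵥ (y + z)) := by
    rw [Matrix.mulVec_add, map_add]
  have h1 := hval y
  have h2 := hval z
  have h3 := hval (y + z)
  rw [← hadd, map_add, hy, hz] at h3
  rw [hy] at h1
  rw [hz] at h2
  simp at h1 h2
  refine ⟨redHom U (P *ᵥ y), redHom U (P *ᵥ z), h1, h2, by simpa using h3,
    fun l hl hly hlz => ?_⟩
  have hpP (x : Fin 3 → ℤ) : P *ᵥ P' *ᵥ x = (p : ℤ) • x := by
    rw [Matrix.mulVec_mulVec, h.mul_eq, Matrix.smul_mulVec, Matrix.one_mulVec]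
  have hzero (x : Fin 3 → ℤ) : redHom U ((p : ℤ) • x) = 0 :=
    (redHom_eq_zero_iff hU.1 _).2 ⟨x, rfl⟩
  have hlift (a : ZMod p) : ∃ k : ℤ, (k : ZMod p) = a := ZMod.intCast_surjective a
  apply Set.Subset.antisymm
  · rintro _ ⟨x, rfl⟩
    obtain ⟨a, ha⟩ := hlift (redHom T x 0)
    obtain ⟨b, hb⟩ := hlift (redHom T x 1)
    obtain ⟨w, hw⟩ := (h.mem_LamSet_iff (x - a • y - b • z)).1 <| by
      rw [hT.mem_LamSet_iff hc' hB hBh]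
      simp only [map_sub, map_smul, hy, hz]
      simp [ha, hb]
    have hx : x = a • y + b • z + P' *ᵥ w := by rw [← hw]; abel
    have hred : redHom U (P *ᵥ x) = a • redHom U (P *ᵥ y) + b • redHom U (P *ᵥ z) := by
      rw [hx, Matrix.mulVec_add, Matrix.mulVec_add, Matrix.mulVec_smul, Matrix.mulVec_smul, hpP,
        map_add, map_add, map_smul, map_smul, hzero, add_zero]
    rw [Set.mem_ofPred_eq, hred, dotProduct_add, dotProduct_smul, dotProduct_smul, hly, hlz]
    simp
  · intro x hx
    obtain ⟨a, b, hab⟩ := exists_eq_add_of_dotProduct_eq_zero h1 h2 (by simpa using h3) hl hly hlz hx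
    obtain ⟨a, rfl⟩ := hlift a
    obtain ⟨b, rfl⟩ := hlift b
    obtain ⟨w, hw⟩ := (redHom_eq_zero_iff hU.1 (x - P *ᵥ (a • y + b • z))).1 <| by
      rw [Matrix.mulVec_add, Matrix.mulVec_smul, Matrix.mulVec_smul, map_sub, map_add, map_smul,
        map_smul, hab, sub_eq_zero]
      ext i
      simp
    refine ⟨a • y + b • z + P' *ᵥ w, ?_⟩
    rw [Matrix.mulVec_add, hpP, ← hw]
    abel

end LocalFrames

/-! ### Forms with a given Watson transform -/

lemma IsFrame.gram_eq' {p : ℕ} {K B : Matrix (Fin 3) (Fin 3) ℚ} {P P' : Matrix (Fin 3) (Fin 3) ℤ}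
    (h : IsFrame p K B P P') : (intMap P')ᵀ * B * intMap P' = (p : ℚ) ^ 2 • K := by
  rw [← h.gram_eq, ← congr_mul, h.mul_eq, intMap_smul, intMap_one]
  simp [smul_smul, sq]

section WatsonFiber

variable {p : ℕ} [Fact p.Prime]

/-- The Watson transform of a form with a frame in `K` is `K`. -/
lemma IsFrame.zEquiv_watson {K B : Matrix (Fin 3) (Fin 3) ℚ} {P P' : Matrix (Fin 3) (Fin 3) ℤ}
    (h : IsFrame p K B P P') {Y : Matrix (Fin 3) (Fin 3) ℤ}
    (hY : ∀ x, x ∈ LamSet p B ↔ ∃ c, x = Y *ᵥ c) :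
    ZEquiv (((p : ℚ) ^ 2)⁻¹ • ((intMap Y)ᵀ * B * intMap Y)) K := by
  have hp : p ≠ 0 := (Fact.out : p.Prime).ne_zero
  have hp2 : (p : ℚ) ^ 2 ≠ 0 := pow_ne_zero _ (by exact_mod_cast hp)
  obtain ⟨X, hX, rfl⟩ := exists_unit_of_range_eq (h.det_ne_zero' hp)
    (fun j => (h.mem_LamSet_iff _).1 ((hY _).2 ⟨Pi.single j 1, rfl⟩))
    (fun j => (hY _).1 ((h.mem_LamSet_iff _).2 ⟨Pi.single j 1, rfl⟩))
  refine ZEquiv.symm ⟨X, hX, ?_⟩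
  rw [congr_mul, h.gram_eq', Matrix.mul_smul, Matrix.smul_mul, smul_smul, inv_mul_cancel₀ hp2,
    one_smul]

/-- The sublattice of `K ≅ H ⊕ [c]` where the last coordinate vanishes modulo `p` is spanned by a
frame of a form in the genus of `L`, where `L ≅ H ⊕ [p²c]` at `p` has Watson transform `K`. -/
lemma exists_isFrame_of_watson {L K : Matrix (Fin 3) (Fin 3) ℚ} {c : ℤ_[p]}
    {U V : Matrix (Fin 3) (Fin 3) ℤ_[p]} (hV : IsLocalForm L ((p : ℤ_[p]) ^ 2 * c) V)
    (hU : IsLocalForm K c U) (hK : PosDef3 K) (hKh : HalfIntegral K)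
    {Y Y' : Matrix (Fin 3) (Fin 3) ℤ} (hYY' : Y * Y' = (p : ℤ) • 1)
    (hLK : (intMap Y)ᵀ * L * intMap Y = (p : ℚ) ^ 2 • K) :
    ∃ A P P', IsFrame p K A P P' ∧ Set.range P.mulVec = {x | redHom U x 2 = 0} ∧
      PosDef3 A ∧ HalfIntegral A ∧ ∀ q : ℕ, ∀ hq : q.Prime, @ZqEquiv q ⟨hq⟩ A L := by
  have hp0 : (p : ℤ) ≠ 0 := by exact_mod_cast (Fact.out : p.Prime).ne_zero
  have hp2 : (p : ℚ) ^ 2 ≠ 0 := pow_ne_zero _ (by exact_mod_cast hp0)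
  obtain ⟨A, P, P', hP, hrange, hA, hAh, S, hS⟩ := hU.exists_isFrame_range_eq hK hKh
  refine ⟨A, P, P', hP, hrange, hA, hAh, fun q hq => ?_⟩
  have : Fact q.Prime := ⟨hq⟩
  by_cases hqp : q = p
  · subst hqp
    exact hS.zqEquiv hV
  refine zqEquiv_of_ne (W := P' * Y') (W' := Y * P) hqp ?_ ?_
  · rw [Matrix.mul_assoc, ← Matrix.mul_assoc Y', mul_comm_of_mul_eq_smul_one hp0 hYY',
      Matrix.smul_mul, Matrix.one_mul, Matrix.mul_smul, mul_comm_of_mul_eq_smul_one hp0 hP.mul_eq,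
      smul_smul, sq]
  · rw [congr_mul, hP.gram_eq', ← hLK, ← congr_mul, hYY', intMap_smul, intMap_one]
    simp [smul_smul, sq]

/-- The product of two Eichler transformations of `H ⊕ [c]`. -/
def eichler (c s t : ℤ_[p]) : Matrix (Fin 3) (Fin 3) ℤ_[p] :=
  !![1, -c * t ^ 2, -2 * c * t; 0, 1, 0; 0, t, 1] *
    !![1, 0, 0; -c * s ^ 2, 1, -2 * c * s; s, 0, 1]

lemma IsLocalForm.eichler_mul {K : Matrix (Fin 3) (Fin 3) ℚ} {c : ℤ_[p]}
    {U : Matrix (Fin 3) (Fin 3) ℤ_[p]} (hU : IsLocalForm K c U) (s t : ℤ_[p]) :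
    IsLocalForm K c (eichler c s t * U) := by
  have two : ((2 : ℤ_[p]) : ℚ_[p]) = 2 := map_ofNat PadicInt.Coe.ringHom 2
  have h1 : (toQp !![1, -c * t ^ 2, -2 * c * t; 0, 1, 0; 0, t, 1])ᵀ * Hblock p (c : ℚ_[p]) *
      toQp !![1, -c * t ^ 2, -2 * c * t; 0, 1, 0; 0, t, 1] = Hblock p (c : ℚ_[p]) := by
    ext i j
    fin_cases i <;> fin_cases j <;>
      simp [Hblock, toQp, Matrix.mul_apply, Fin.sum_univ_three, two] <;> ring
  have h2 : (toQp !![1, 0, 0; -c * s ^ 2, 1, -2 * c * s; s, 0, 1])ᵀ * Hblock p (c : ℚ_[p]) *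
      toQp !![1, 0, 0; -c * s ^ 2, 1, -2 * c * s; s, 0, 1] = Hblock p (c : ℚ_[p]) := by
    ext i j
    fin_cases i <;> fin_cases j <;>
      simp [Hblock, toQp, Matrix.mul_apply, Fin.sum_univ_three, two] <;> ring
  refine ⟨?_, ?_⟩
  · have hdet : (eichler c s t).det = 1 := by
      rw [eichler, Matrix.det_mul, Matrix.det_fin_three, Matrix.det_fin_three]
      simp
    rw [Matrix.det_mul, hdet, one_mul]
    exact hU.1
  · rw [hU.2, eichler, toQp_mul, toQp_mul, Matrix.transpose_mul, Matrix.transpose_mul]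
    nth_rewrite 1 [← h2, ← h1]
    simp only [Matrix.mul_assoc]

lemma redHom_eichler_mul (c s t : ℤ_[p]) (U : Matrix (Fin 3) (Fin 3) ℤ_[p]) (x : Fin 3 → ℤ) :
    redHom (eichler c s t * U) x 2 =
      ![PadicInt.toZMod s - PadicInt.toZMod c * PadicInt.toZMod t * PadicInt.toZMod s ^ 2,
        PadicInt.toZMod t, 1 - 2 * PadicInt.toZMod c * PadicInt.toZMod s * PadicInt.toZMod t] ⬝ᵥ
        redHom U x := by
  simp only [redHom_apply, ← Matrix.mulVec_mulVec, dotProduct, Fin.sum_univ_three]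
  have two : PadicInt.toZMod (2 : ℤ_[p]) = 2 := map_ofNat _ 2
  simp [eichler, Matrix.mulVec, Matrix.mul_apply, dotProduct, Fin.sum_univ_three, two]
  ring

end WatsonFiber

/-- A family of linear forms whose kernels are the planes on which the quadratic form
`w₀ w₁ + c w₂²` is hyperbolic. -/
structure IsHyperbolicFamily {F J : Type*} [Field F] (c : F) (l : J → Fin 3 → F) : Prop where
  ker_injective : ∀ i j, (∀ w, l i ⬝ᵥ w = 0 ↔ l j ⬝ᵥ w = 0) → i = j
  exists_eichler : ∀ j, ∃ s t μ : F, μ ≠ 0 ∧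
    l j = μ • ![s - c * t * s ^ 2, t, 1 - 2 * c * s * t]
  exists_of_pair : ∀ u v : Fin 3 → F, u 0 * u 1 + c * u 2 ^ 2 = 0 → v 0 * v 1 + c * v 2 ^ 2 = 0 →
    (u + v) 0 * (u + v) 1 + c * (u + v) 2 ^ 2 = 1 → ∃ j, l j ⬝ᵥ u = 0 ∧ l j ⬝ᵥ v = 0

lemma IsHyperbolicFamily.ne_zero {F J : Type*} [Field F] {c : F} {l : J → Fin 3 → F}
    (hl : IsHyperbolicFamily c l) (j : J) : l j ≠ 0 := by
  obtain ⟨s, t, μ, hμ, h⟩ := hl.exists_eichler j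
  rw [h]
  intro h0
  have h1 : t = 0 := by simpa [hμ] using congrFun h0 1
  have h2 := congrFun h0 2
  simp [h1, hμ] at h2

section WatsonSum

variable {p : ℕ} [Fact p.Prime]

/-- The weighted sum of representation numbers over the forms in the genus of `L` with Watson
transform `K`, in terms of the hyperbolic planes of `K` modulo `p`. -/
theorem sum_rEval_div_autNum_eq_sum_card {L K : Matrix (Fin 3) (Fin 3) ℚ} {c : ℤ_[p]}
    {U V : Matrix (Fin 3) (Fin 3) ℤ_[p]} (hV : IsLocalForm L ((p : ℤ_[p]) ^ 2 * c) V)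
    (hU : IsLocalForm K c U) (hK : PosDef3 K) (hKh : HalfIntegral K)
    {Y Y' : Matrix (Fin 3) (Fin 3) ℤ} (hYY' : Y * Y' = (p : ℤ) • 1)
    (hLK : (intMap Y)ᵀ * L * intMap Y = (p : ℚ) ^ 2 • K)
    {ι J : Type*} [Fintype ι] [Fintype J] {Ls : ι → Matrix (Fin 3) (Fin 3) ℚ}
    (hLs : ∀ i, PosDef3 (Ls i) ∧ HalfIntegral (Ls i))
    (hLsne : ∀ i j, i ≠ j → ¬ ZEquiv (Ls i) (Ls j))
    (hLsloc : ∀ i, ZqEquiv p (Ls i) L)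
    (hLslam : ∀ i, ∀ Y : Matrix (Fin 3) (Fin 3) ℤ,
      (∀ x, x ∈ LamSet p (Ls i) ↔ ∃ c, x = Y *ᵥ c) →
      ZEquiv (((p : ℚ) ^ 2)⁻¹ • ((intMap Y)ᵀ * Ls i * intMap Y)) K)
    (hLscomp : ∀ A : Matrix (Fin 3) (Fin 3) ℚ, PosDef3 A → HalfIntegral A →
      (∀ q : ℕ, ∀ hq : q.Prime, @ZqEquiv q ⟨hq⟩ A L) →
      (∀ Y : Matrix (Fin 3) (Fin 3) ℤ, (∀ x, x ∈ LamSet p A ↔ ∃ c, x = Y *ᵥ c) →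
        ZEquiv (((p : ℚ) ^ 2)⁻¹ • ((intMap Y)ᵀ * A * intMap Y)) K) → ∃ i, ZEquiv A (Ls i))
    {l : J → Fin 3 → ZMod p} (hl : IsHyperbolicFamily (PadicInt.toZMod c) l) (n : ℤ) :
    ∑ i, (rEval (Ls i) n : ℚ) / (autNum (Ls i) : ℚ) =
      (∑ x ∈ (hK.finite_qf_eq n).toFinset, (Nat.card {j // l j ⬝ᵥ redHom U x = 0} : ℚ)) /
        (autNum K : ℚ) := by
  classical
  have hp : p ≠ 0 := (Fact.out : p.Prime).ne_zero
  have hdvd : (p : ℤ_[p]) ∣ (p : ℤ_[p]) ^ 2 * c := (dvd_pow_self _ two_ne_zero).mul_right c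
  choose T hT using fun i => (hLsloc i).exists_isLocalForm hV
  rw [sum_rEval_div_autNum hp hK (fun i => (hLs i).1) hLsne
    (M := fun j => {x | l j ⬝ᵥ redHom U x = 0}) (n := n)]
  · congr 1
    have h1 (j : J) : Nat.card {x // x ∈ {x | l j ⬝ᵥ redHom U x = 0} ∧ qf K x = n} =
        ∑ x ∈ (hK.finite_qf_eq n).toFinset, if l j ⬝ᵥ redHom U x = 0 then 1 else 0 := by
      rw [← Finset.card_filter]
      refine Nat.subtype_card _ fun x => ?_
      simp [and_comm]
    have h2 (x : Fin 3 → ℤ) : Nat.card {j // l j ⬝ᵥ redHom U x = 0} =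
        ∑ j, if l j ⬝ᵥ redHom U x = 0 then 1 else 0 := by
      rw [← Finset.card_filter]
      exact Nat.subtype_card _ (by simp)
    simp only [h1, h2]
    push_cast
    exact Finset.sum_comm
  · intro i j hij
    refine hl.ker_injective i j fun w => ?_
    obtain ⟨x, rfl⟩ := redHom_surjective hU.1 w
    exact Set.ext_iff.1 hij x
  · exact fun i => exists_isFrame (hT i) hdvd (hLs i).1.1 (hLs i).2 (hLslam i)
  · intro i P P' h
    obtain ⟨u, v, hu, hv, huv, hrange⟩ :=
      h.exists_hyperbolic_pair (hT i) hdvd hU hK.1 hKh (hLs i).1.1 (hLs i).2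
    obtain ⟨j, hju, hjv⟩ := hl.exists_of_pair u v hu hv huv
    exact ⟨j, hrange _ (hl.ne_zero j) hju hjv⟩
  · intro j
    obtain ⟨s, t, μ, hμ, hj⟩ := hl.exists_eichler j
    obtain ⟨s, rfl⟩ := ZMod.ringHom_surjective (PadicInt.toZMod (p := p)) s
    obtain ⟨t, rfl⟩ := ZMod.ringHom_surjective (PadicInt.toZMod (p := p)) t
    obtain ⟨A, P, P', hP, hrange, hA, hAh, hAL⟩ :=
      exists_isFrame_of_watson hV (hU.eichler_mul s t) hK hKh hYY' hLK
    obtain ⟨i, Z, hZ, hZi⟩ := hLscomp A hA hAh hAL fun Y hY => hP.zEquiv_watson hY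
    refine ⟨i, P * Z, Z⁻¹ * P', hZi ▸ hP.mul_unit hZ, ?_⟩
    rw [IsFrame.range_mul_unit hZ, hrange]
    ext x
    rw [Set.mem_ofPred_eq, Set.mem_ofPred_eq, redHom_eichler_mul, hj, smul_dotProduct, smul_eq_mul,
      mul_eq_zero_iff_left hμ]

lemma card_sq_mul_qf_eq {K : Matrix (Fin 3) (Fin 3) ℚ} {U : Matrix (Fin 3) (Fin 3) ℤ_[p]}
    (hU : IsUnit U.det) (r : ℚ) :
    Nat.card {x : Fin 3 → ℤ // (p : ℚ) ^ 2 * qf K x = r} =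
      Nat.card {x : Fin 3 → ℤ // qf K x = r ∧ redHom U x = 0} := by
  have hp : (p : ℤ) ≠ 0 := by exact_mod_cast (Fact.out : p.Prime).ne_zero
  refine Nat.card_congr (Equiv.ofBijective (fun x => ⟨(p : ℤ) • x.1, ?_, ?_⟩) ⟨?_, ?_⟩)
  · rw [qf_smul]
    exact_mod_cast x.2
  · exact (redHom_eq_zero_iff hU _).2 ⟨_, rfl⟩
  · intro x y hxy
    exact Subtype.ext (smul_right_injective _ hp (congrArg Subtype.val hxy))
  · rintro ⟨x, hx, hx0⟩
    obtain ⟨z, rfl⟩ := (redHom_eq_zero_iff hU x).1 hx0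
    rw [qf_smul] at hx
    exact ⟨⟨z, by exact_mod_cast hx⟩, rfl⟩

lemma natCast_card_eq_sum {α : Type*} {s : Set α} (hs : s.Finite) (q : α → Prop)
    [DecidablePred q] : (Nat.card {x // x ∈ s ∧ q x} : ℚ) =
      ∑ x ∈ hs.toFinset, if q x then 1 else 0 := by
  rw [Finset.sum_boole, Nat.cast_inj]
  exact Nat.subtype_card _ (by simp)

end WatsonSum

/-! ### Hyperbolic planes over finite fields -/

section FiniteField

variable {F : Type*} [Field F]

lemma isHyperbolicFamily_zero : IsHyperbolicFamily (0 : F) fun q : F × F => ![q.1, q.2, 1] where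
  ker_injective := by
    rintro ⟨s, t⟩ ⟨s', t'⟩ h
    have h0 := (h ![1, 0, -s]).1 (by simp [dotProduct, Fin.sum_univ_three])
    have h1 := (h ![0, 1, -t]).1 (by simp [dotProduct, Fin.sum_univ_three])
    simp only [dotProduct, Fin.sum_univ_three] at h0 h1
    ext
    · simp at h0 ⊢
      linear_combination -h0
    · simp at h1 ⊢
      linear_combination -h1
  exists_eichler q := ⟨q.1, q.2, 1, one_ne_zero, by simp⟩
  exists_of_pair u v hu hv huv := by
    simp only [Pi.add_apply, zero_mul, add_zero] at hu hv huv
    wlog hu0 : u 0 = 0 generalizing u v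
    · have hu1 : u 1 = 0 := (mul_eq_zero.1 hu).resolve_left hu0
      have hv0 : v 0 = 0 := by
        refine (mul_eq_zero.1 hv).resolve_right fun hv1 => ?_
        simp [hu1, hv1] at huv
      obtain ⟨j, hj⟩ := this v u hv hu (by rw [← huv]; ring) hv0
      exact ⟨j, hj.symm⟩
    have hu1 : u 1 ≠ 0 := by
      intro hu1
      simp [hu0, hu1, hv] at huv
    have hv0 : v 0 ≠ 0 := by
      intro hv0
      simp [hu0, hv0] at huv
    have hv1 : v 1 = 0 := (mul_eq_zero.1 hv).resolve_left hv0
    refine ⟨(-(v 2 / v 0), -(u 2 / u 1)), ?_, ?_⟩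
    · simp [dotProduct, Fin.sum_univ_three, hu0, hu1]
    · simp [dotProduct, Fin.sum_univ_three, hv0, hv1]

lemma card_ker_zero [Finite F] [DecidableEq F] (w : Fin 3 → F) :
    (Nat.card {q : F × F // ![q.1, q.2, 1] ⬝ᵥ w = 0} : ℚ) =
      Nat.card F + (if w = 0 then (Nat.card F : ℚ) ^ 2 else 0) -
        if w 0 = 0 ∧ w 1 = 0 then (Nat.card F : ℚ) else 0 := by
  have hdot (q : F × F) : ![q.1, q.2, 1] ⬝ᵥ w = q.1 * w 0 + q.2 * w 1 + w 2 := by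
    simp [dotProduct, Fin.sum_univ_three]
  simp only [hdot]
  by_cases h0 : w 0 = 0
  · by_cases h1 : w 1 = 0
    · by_cases h2 : w 2 = 0
      · have hw : w = 0 := by ext i; fin_cases i <;> assumption
        simp [hw, sq]
      · have hw : w ≠ 0 := fun h => h2 (congrFun h 2)
        simp [h0, h1, h2, hw]
    · have hw : w ≠ 0 := fun h => h1 (congrFun h 1)
      have e : {q : F × F // q.1 * w 0 + q.2 * w 1 + w 2 = 0} ≃ F :=
        { toFun q := q.1.1
          invFun s := ⟨(s, -(w 2 / w 1)), by simp [h0, h1]⟩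
          left_inv := by
            rintro ⟨⟨s, t⟩, h⟩
            simp only [h0, mul_zero, zero_add] at h
            simp only [Subtype.mk.injEq, Prod.mk.injEq, true_and]
            field_simp
            linear_combination -h
          right_inv _ := rfl }
      simp [Nat.card_congr e, h1, hw]
  · have hw : w ≠ 0 := fun h => h0 (congrFun h 0)
    have e : {q : F × F // q.1 * w 0 + q.2 * w 1 + w 2 = 0} ≃ F :=
      { toFun q := q.1.2
        invFun t := ⟨(-((t * w 1 + w 2) / w 0), t), by field_simp; ring⟩
        left_inv := by
          rintro ⟨⟨s, t⟩, h⟩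
          simp only [Subtype.mk.injEq, Prod.mk.injEq, and_true]
          field_simp
          linear_combination -h
        right_inv _ := rfl }
    simp [Nat.card_congr e, h0, hw]

/-- The linear form whose kernel meets the conic `w₀ w₁ + c w₂² = 0` in the points
`(1, -c s², s)` and `(1, -c t², t)`. -/
def secantForm (c : F) : Sym2 F → Fin 3 → F :=
  Sym2.lift ⟨fun s t => ![c * (s * t), -1, -(c * (s + t))], fun s t => by
    simp only [mul_comm s, add_comm s]⟩

lemma secantForm_mk (c s t : F) :
    secantForm c s(s, t) = ![c * (s * t), -1, -(c * (s + t))] := rfl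

lemma secantForm_dotProduct_eq_zero_iff {c : F} (hc : c ≠ 0) (e : Sym2 F) {w : Fin 3 → F}
    (hw : w 0 * w 1 + c * w 2 ^ 2 = 0) (h0 : w 0 ≠ 0) :
    secantForm c e ⬝ᵥ w = 0 ↔ w 2 / w 0 ∈ e := by
  induction e with
  | h s t =>
    have h : w 0 * (secantForm c s(s, t) ⬝ᵥ w) = c * ((w 2 - s * w 0) * (w 2 - t * w 0)) := by
      simp [secantForm_mk, dotProduct, Fin.sum_univ_three]
      linear_combination -hw
    rw [Sym2.mem_iff, div_eq_iff h0, div_eq_iff h0, ← sub_eq_zero (a := w 2),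
      ← sub_eq_zero (a := w 2), ← mul_eq_zero, ← mul_eq_zero_iff_left h0, h,
      mul_eq_zero_iff_left hc]

/-- The linear forms whose kernels meet the conic `w₀ w₁ + c w₂² = 0` in two points. -/
def hyperbolicForm (c : F) : {e : Sym2 F // ¬ e.IsDiag} ⊕ F → Fin 3 → F :=
  Sum.elim (fun e => secantForm c e.1) fun t => ![-t, 0, 1]

lemma secantForm_dotProduct_of_zero {c : F} (e : Sym2 F) {w : Fin 3 → F} (h0 : w 0 = 0)
    (h2 : w 2 = 0) : secantForm c e ⬝ᵥ w = -w 1 := by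
  induction e with
  | h s t => simp [secantForm_mk, dotProduct, Fin.sum_univ_three, h0, h2]

lemma isHyperbolicFamily_hyperbolicForm {c : F} (hc : c ≠ 0) :
    IsHyperbolicFamily c (hyperbolicForm c) where
  ker_injective := by
    have hl (e : {e : Sym2 F // ¬ e.IsDiag}) (t : F)
        (h : ∀ w, hyperbolicForm c (.inl e) ⬝ᵥ w = 0 ↔ hyperbolicForm c (.inr t) ⬝ᵥ w = 0) :
        False := by
      have := (h ![0, 1, 0]).2 (by simp [hyperbolicForm])
      rw [hyperbolicForm, Sum.elim_inl, secantForm_dotProduct_of_zero _ rfl rfl] at this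
      simp at this
    rintro (e | t) (e' | t') h
    · congr 1
      ext r
      have hr : ![1, -(c * r ^ 2), r] 0 * ![1, -(c * r ^ 2), r] 1 +
          c * ![1, -(c * r ^ 2), r] 2 ^ 2 = 0 := by simp
      have := h ![1, -(c * r ^ 2), r]
      simp only [hyperbolicForm, Sum.elim_inl] at this
      rw [secantForm_dotProduct_eq_zero_iff hc _ hr one_ne_zero,
        secantForm_dotProduct_eq_zero_iff hc _ hr one_ne_zero] at this
      simpa using this
    · exact (hl e t' h).elim
    · exact (hl e' t fun w => (h w).symm).elim
    · have := (h ![1, 0, t]).1 (by simp [hyperbolicForm, dotProduct, Fin.sum_univ_three])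
      simp [hyperbolicForm, dotProduct, Fin.sum_univ_three] at this
      congr 1
      linear_combination this
  exists_eichler := by
    rintro (⟨e, he⟩ | t)
    · induction e with
      | h s t =>
        have hst : t - s ≠ 0 := sub_ne_zero.2 fun h => he (Sym2.mk_isDiag_iff.2 h.symm)
        refine ⟨-s, 1 / (c * (t - s)), -(c * (t - s)), by simp [hc, hst], ?_⟩
        ext i
        fin_cases i <;> simp [hyperbolicForm, secantForm_mk] <;> field_simp <;> ring
    · exact ⟨-t, 0, 1, one_ne_zero, by simp [hyperbolicForm]⟩
  exists_of_pair u v hu hv huv := by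
    have zero {w : Fin 3 → F} (hw : w 0 * w 1 + c * w 2 ^ 2 = 0) (h : w 0 = 0) : w 2 = 0 := by
      simpa [h, hc] using hw
    simp only [Pi.add_apply] at huv
    have hB : u 0 * v 1 + u 1 * v 0 + 2 * c * u 2 * v 2 = 1 := by linear_combination huv - hu - hv
    by_cases hu0 : u 0 = 0
    · have hv0 : v 0 ≠ 0 := by
        intro hv0
        simp [hu0, hv0, zero hu hu0] at hB
      refine ⟨.inr (v 2 / v 0), ?_, ?_⟩ <;>
        simp [hyperbolicForm, dotProduct, Fin.sum_univ_three, hu0, zero hu, hv0]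
    by_cases hv0 : v 0 = 0
    · refine ⟨.inr (u 2 / u 0), ?_, ?_⟩ <;>
        simp [hyperbolicForm, dotProduct, Fin.sum_univ_three, hu0, zero hv, hv0]
    have hne : u 2 / u 0 ≠ v 2 / v 0 := by
      intro h
      rw [div_eq_div_iff hu0 hv0] at h
      have h1 : u 0 * v 0 = 0 := by
        linear_combination -(u 0 * v 0) * hB + v 0 ^ 2 * hu + u 0 ^ 2 * hv -
          c * (u 2 * v 0 - v 2 * u 0) * h
      exact mul_ne_zero hu0 hv0 h1
    refine ⟨.inl ⟨s(u 2 / u 0, v 2 / v 0), fun h => hne (Sym2.mk_isDiag_iff.1 h)⟩, ?_, ?_⟩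
    · exact (secantForm_dotProduct_eq_zero_iff hc _ hu hu0).2 (Sym2.mem_mk_left _ _)
    · exact (secantForm_dotProduct_eq_zero_iff hc _ hv hv0).2 (Sym2.mem_mk_right _ _)

lemma natCard_not_isDiag_mem {α : Type*} [Finite α] (r : α) :
    Nat.card {e : {e : Sym2 α // ¬ e.IsDiag} // r ∈ e.1} = Nat.card α - 1 := by
  have h : Nat.card {s : α // s ≠ r} = Nat.card α - 1 := by
    classical
    have := Fintype.ofFinite α
    simp [Nat.card_eq_fintype_card, Fintype.card_subtype_compl]
  rw [← h]
  refine (Nat.card_congr (Equiv.ofBijective (fun s => ⟨⟨s(r, s.1), fun hs =>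
    s.2 (Sym2.mk_isDiag_iff.1 hs).symm⟩, Sym2.mem_mk_left _ _⟩) ⟨?_, ?_⟩)).symm
  · intro s t hst
    exact Subtype.ext (Sym2.congr_right.1 (congrArg (fun e => e.1.1) hst))
  · rintro ⟨⟨e, hd⟩, s, hs⟩
    obtain rfl : e = s(r, s) := hs
    exact ⟨⟨s, fun hs => hd (Sym2.mk_isDiag_iff.2 hs.symm)⟩, rfl⟩

lemma card_ker_hyperbolicForm [Finite F] [DecidableEq F] {c : F} (hc : c ≠ 0) {w : Fin 3 → F}
    (hw : w 0 * w 1 + c * w 2 ^ 2 = 0) :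
    (Nat.card {j // hyperbolicForm c j ⬝ᵥ w = 0} : ℚ) =
      Nat.card F + if w = 0 then (Nat.card F : ℚ) * (Nat.card F - 1) / 2 else 0 := by
  rw [Nat.card_congr Equiv.subtypeSum, Nat.card_sum]
  simp only [hyperbolicForm, Sum.elim_inl, Sum.elim_inr]
  by_cases h0 : w 0 = 0
  · have h2 : w 2 = 0 := by simpa [h0, hc] using hw
    have hdot (t : F) : ![-t, 0, 1] ⬝ᵥ w = 0 := by
      simp [dotProduct, Fin.sum_univ_three, h0, h2]
    simp only [secantForm_dotProduct_of_zero _ h0 h2, hdot]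
    by_cases h1 : w 1 = 0
    · have hw0 : w = 0 := by ext i; fin_cases i <;> assumption
      simp [hw0, Sym2.natCard_subtype_not_diag, Nat.cast_choose_two, add_comm]
    · have hw0 : w ≠ 0 := fun h => h1 (congrFun h 1)
      simp [h1, hw0]
  · have hw0 : w ≠ 0 := fun h => h0 (congrFun h 0)
    have hs (e : Sym2 F) : secantForm c e ⬝ᵥ w = 0 ↔ w 2 / w 0 ∈ e :=
      secantForm_dotProduct_eq_zero_iff hc e hw h0
    have ht (t : F) : ![-t, 0, 1] ⬝ᵥ w = 0 ↔ t = w 2 / w 0 := by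
      rw [eq_div_iff h0]
      simp [dotProduct, Fin.sum_univ_three, neg_add_eq_zero]
    simp only [hs, ht, natCard_not_isDiag_mem]
    simp [hw0, Nat.cast_sub (Nat.one_le_iff_ne_zero.2 Nat.card_pos.ne')]

end FiniteField

/-- Let `p` be a prime, `m ≥ 2`, and `L` a positive definite half-integral ternary form with
Gram matrix ℤ_p-equivalent to `H ⊕ [p^m ε]`, with Watson transform `K = λ_p(L)`.  If
`L₁,…,L_g` are class representatives of the forms in the genus of `L` whose λ_p-transform
is isometric to `K`, then for `p ∣ n`:
`∑_i r(n,L_i)/o(L_i) = p r(n,K)/o(K) + (p(p−1)/2) r(n/p²,K)/o(K)` if `m = 2`, and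
`∑_i r(n,L_i)/o(L_i) = p r(n,K)/o(K) + p² r(n/p²,K)/o(K) − p #{x ∈ Λ_p(K) : f_K(x)=n}/o(K)`
if `m ≥ 3`. -/
theorem stmt_15 (p : ℕ) [Fact p.Prime] (ε : ℤ_[p]ˣ) (m : ℕ) (hm : 2 ≤ m)
    (L : Matrix (Fin 3) (Fin 3) ℚ) (hL : PosDef3 L) (hLh : HalfIntegral L)
    (hLp : ZpEquivTo p L (Hblock p ((p : ℚ_[p]) ^ m * ((ε : ℤ_[p]) : ℚ_[p]))))
    (K : Matrix (Fin 3) (Fin 3) ℚ) (hK : PosDef3 K) (hKh : HalfIntegral K)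
    (YK : Matrix (Fin 3) (Fin 3) ℤ)
    (hYK : ∀ x, x ∈ LamSet p L ↔ ∃ c, x = YK.mulVec c)
    (hKgram : (intMap YK)ᵀ * L * intMap YK = (p : ℚ) ^ 2 • K)
    (g : ℕ) (Ls : Fin g → Matrix (Fin 3) (Fin 3) ℚ)
    (hLs : ∀ i, PosDef3 (Ls i) ∧ HalfIntegral (Ls i))
    (hLsne : ∀ i j, i ≠ j → ¬ ZEquiv (Ls i) (Ls j))
    (hLsloc : ∀ i, ∀ q : ℕ, ∀ hq : q.Prime, @ZqEquiv q ⟨hq⟩ (Ls i) L)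
    (hLslam : ∀ i, ∀ Y : Matrix (Fin 3) (Fin 3) ℤ,
      (∀ x, x ∈ LamSet p (Ls i) ↔ ∃ c, x = Y.mulVec c) →
      ZEquiv (((p : ℚ) ^ 2)⁻¹ • ((intMap Y)ᵀ * Ls i * intMap Y)) K)
    (hLscomp : ∀ A : Matrix (Fin 3) (Fin 3) ℚ, PosDef3 A → HalfIntegral A →
      (∀ q : ℕ, ∀ hq : q.Prime, @ZqEquiv q ⟨hq⟩ A L) →
      (∀ Y : Matrix (Fin 3) (Fin 3) ℤ,
        (∀ x, x ∈ LamSet p A ↔ ∃ c, x = Y.mulVec c) →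
        ZEquiv (((p : ℚ) ^ 2)⁻¹ • ((intMap Y)ᵀ * A * intMap Y)) K) →
      ∃ i, ZEquiv A (Ls i)) :
    ∀ n : ℤ, 0 < n → (p : ℤ) ∣ n →
      (m = 2 →
        ∑ i, (rEval (Ls i) n : ℚ) / (autNum (Ls i) : ℚ)
          = (p : ℚ) * (rEval K n : ℚ) / (autNum K : ℚ)
            + ((p : ℚ) * ((p : ℚ) - 1) / 2)
              * (Nat.card {x : Fin 3 → ℤ // (p : ℚ) ^ 2 * qf K x = (n : ℚ)} : ℚ)
              / (autNum K : ℚ)) ∧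
      (3 ≤ m →
        ∑ i, (rEval (Ls i) n : ℚ) / (autNum (Ls i) : ℚ)
          = (p : ℚ) * (rEval K n : ℚ) / (autNum K : ℚ)
            + (p : ℚ) ^ 2
              * (Nat.card {x : Fin 3 → ℤ // (p : ℚ) ^ 2 * qf K x = (n : ℚ)} : ℚ)
              / (autNum K : ℚ)
            - (p : ℚ)
              * (Nat.card {x : Fin 3 → ℤ // x ∈ LamSet p K ∧ qf K x = (n : ℚ)} : ℚ)
              / (autNum K : ℚ)) := by
  have hp : p.Prime := Fact.out
  have hp0 : (p : ℤ) ≠ 0 := by exact_mod_cast hp.ne_zero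
  intro n _ hpn
  set c : ℤ_[p] := (p : ℤ_[p]) ^ (m - 2) * ε with hc
  obtain ⟨V, hV⟩ : ∃ V, IsLocalForm L ((p : ℤ_[p]) ^ 2 * c) V := by
    refine ZpEquivTo.exists_isLocalForm ?_
    have : (p : ℤ_[p]) ^ 2 * c = (p : ℤ_[p]) ^ m * ε := by
      rw [hc, ← mul_assoc, ← pow_add, Nat.add_sub_cancel' hm]
    rw [this]
    exact_mod_cast hLp
  obtain ⟨YK', hYY'⟩ := exists_mul_eq_smul_one (Y := YK) (p := p) fun x => by
    rw [← hYK, hV.mem_LamSet_iff ((dvd_pow_self _ two_ne_zero).mul_right c) hL.1 hLh]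
    have := (redHom_eq_zero_iff hV.1 ((p : ℤ) • x)).2 ⟨x, rfl⟩
    exact ⟨congrFun this 0, congrFun this 1⟩
  obtain ⟨U, hU⟩ := hV.exists_watson hL.1 hLh hYY' hYK hKgram
  have hsum {J : Type} [Fintype J] {l : J → Fin 3 → ZMod p}
      (hl : IsHyperbolicFamily (PadicInt.toZMod c) l) :=
    sum_rEval_div_autNum_eq_sum_card hV hU hK hKh hYY' hKgram hLs hLsne
      (fun i => hLsloc i p hp) hLslam hLscomp hl n
  have hr : (rEval K n : ℚ) = ∑ x ∈ (hK.finite_qf_eq n).toFinset, 1 := by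
    simpa [rEval] using natCast_card_eq_sum (hK.finite_qf_eq n) fun _ => True
  have hr2 : (Nat.card {x : Fin 3 → ℤ // (p : ℚ) ^ 2 * qf K x = (n : ℚ)} : ℚ) =
      ∑ x ∈ (hK.finite_qf_eq n).toFinset, if redHom U x = 0 then 1 else 0 := by
    rw [card_sq_mul_qf_eq hU.1, ← natCast_card_eq_sum]
    rfl
  have hiso {x : Fin 3 → ℤ} (hx : x ∈ (hK.finite_qf_eq n).toFinset) :
      redHom U x 0 * redHom U x 1 + PadicInt.toZMod c * redHom U x 2 ^ 2 = 0 := by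
    rw [← hU.intCast_qf (by simpa using hx)]
    exact (ZMod.intCast_zmod_eq_zero_iff_dvd n p).2 hpn
  constructor
  · rintro rfl
    have hc0 : PadicInt.toZMod c ≠ 0 := by
      simpa [hc] using (ε.isUnit.map (PadicInt.toZMod (p := p))).ne_zero
    have := Fintype.ofFinite ({e : Sym2 (ZMod p) // ¬ e.IsDiag} ⊕ ZMod p)
    rw [hsum (isHyperbolicFamily_hyperbolicForm hc0),
      Finset.sum_congr rfl fun x hx => card_ker_hyperbolicForm hc0 (hiso hx), hr, hr2, ← add_div,
      Finset.mul_sum, Finset.mul_sum, ← Finset.sum_add_distrib]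
    simp
  · intro hm3
    have hpc : (p : ℤ_[p]) ∣ c := (dvd_pow_self _ (by omega)).mul_right _
    have hc0 : PadicInt.toZMod c = 0 := (toZMod_eq_zero_iff c).2 hpc
    have hr3 : (Nat.card {x : Fin 3 → ℤ // x ∈ LamSet p K ∧ qf K x = (n : ℚ)} : ℚ) =
        ∑ x ∈ (hK.finite_qf_eq n).toFinset,
          if redHom U x 0 = 0 ∧ redHom U x 1 = 0 then 1 else 0 := by
      rw [← natCast_card_eq_sum]
      simp only [hU.mem_LamSet_iff hpc hK.1 hKh, and_comm, Set.mem_ofPred_eq]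
    rw [hsum (hc0 ▸ isHyperbolicFamily_zero), Finset.sum_congr rfl fun x _ => card_ker_zero _, hr,
      hr2, hr3, ← add_div, ← sub_div, Finset.mul_sum, Finset.mul_sum, Finset.mul_sum,
      ← Finset.sum_add_distrib, ← Finset.sum_sub_distrib]
    simp
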